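/- Let (A_n)_{n≥1} be a sequence of positive reals, let β_n = ln(12)/9 + (ln A_n)/3^n, and let Z_n(β_n) = H(n)·exp(−β_n·(3^{n+1}+1)/2). Then: (i) if 2^{8n/3}/A_n → 0 as n → ∞, then Z_n(β_n) → 0; (ii) if 2^{8n/3}/A_n → ∞, then Z_n(β_n) → ∞; (iii) if A_n / 2^{8n/3} → 1, then Z_n(β_n) converges to a finite positive limit. -/

import Mathlib

open scoped Classical
open Filter Topology

noncomputable section

namespace SierpinskiGasket

/-- √3 -/
def sq3 : ℝ := Real.sqrt 3

/-- the origin, leftmost outmost vertex of every `SG n` -/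
def o : ℝ × ℝ := (0, 0)

/-- `a m = (2^m, 0)`, the rightmost vertex of `SG m` (also a translation vector). -/
def a (m : ℕ) : ℝ × ℝ := ((2:ℝ) ^ m, 0)

/-- `b m = (2^(m-1), 2^(m-1)·√3)`, the topmost vertex of `SG m`. -/
def b (m : ℕ) : ℝ × ℝ := ((2:ℝ) ^ m / 2, (2:ℝ) ^ m / 2 * sq3)

/-- `c m = (3·2^(m-1), 2^(m-1)·√3)`. -/
def c (m : ℕ) : ℝ × ℝ := (3 * (2:ℝ) ^ m / 2, (2:ℝ) ^ m / 2 * sq3)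

/-- vertex set of `SG n` -/
def V : ℕ → Set (ℝ × ℝ)
  | 0 => {o, a 0, b 0}
  | n + 1 => V n ∪ ((· + a n) '' V n) ∪ ((· + b n) '' V n)

/-- edge set of `SG n` -/
def E : ℕ → Set (Sym2 (ℝ × ℝ))
  | 0 => {s(o, a 0), s(o, b 0), s(a 0, b 0)}
  | n + 1 => E n ∪ (Sym2.map (· + a n) '' E n) ∪ (Sym2.map (· + b n) '' E n)

/-- `SG n` as a simple graph on `ℝ × ℝ` -/
def G (n : ℕ) : SimpleGraph (ℝ × ℝ) := SimpleGraph.fromEdgeSet (E n)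

/-- a Hamiltonian path of `SG n`: a path visiting every vertex of `SG n` exactly once -/
def IsHamPath (n : ℕ) {u v : ℝ × ℝ} (p : (G n).Walk u v) : Prop :=
  p.IsPath ∧ ∀ x, x ∈ p.support ↔ x ∈ V n

/-- a Hamiltonian cycle of `SG n` -/
def IsHamCycle (n : ℕ) {u : ℝ × ℝ} (p : (G n).Walk u u) : Prop :=
  p.IsCycle ∧ ∀ x, x ∈ p.support ↔ x ∈ V n

/-- `f n u v`: the number of Hamiltonian paths of `SG n` with end-vertex set `{u, v}`
(for `u ≠ v`, such unordered paths correspond bijectively to walks from `u` to `v`). -/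
def f (n : ℕ) (u v : ℝ × ℝ) : ℕ := Nat.card {p : (G n).Walk u v // IsHamPath n p}

/-- `f1 n`: the number of Hamiltonian paths of `SG n` with end-vertex set `{o, a n}` -/
def f1 (n : ℕ) : ℕ := f n o (a n)

/-- the number of Hamiltonian cycles of `SG n`, counted up to starting vertex and
orientation: every Hamiltonian cycle passes through `o` and has exactly two
representatives as a closed walk based at `o`. -/
def HC (n : ℕ) : ℕ := Nat.card {p : (G n).Walk o o // IsHamCycle n p} / 2

/-- the number of Hamiltonian paths of `SG n` having `o` as one of their end vertices -/
def H0 (n : ℕ) : ℕ := ∑ᶠ x ∈ {x : ℝ × ℝ | x ≠ o}, f n o x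

/-- the total number of Hamiltonian paths of `SG n` (a path and its reversal
are the same unordered object, whence the division by `2`). -/
def H (n : ℕ) : ℕ := (∑ᶠ u : ℝ × ℝ, ∑ᶠ v : ℝ × ℝ, f n u v) / 2

/-- the distribution ratio `F(n,x) = f(n,x)/f1(n)` -/
def F (n : ℕ) (x : ℝ × ℝ) : ℝ := (f n o x : ℝ) / (f1 n : ℝ)

/-- `SG n` with the vertex `b n` (and its incident edges) deleted -/
def Gd (n : ℕ) : SimpleGraph (ℝ × ℝ) := SimpleGraph.fromEdgeSet {e ∈ E n | b n ∉ e}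

/-- Hamiltonian path of `SG n - b n` -/
def IsHamPathD (n : ℕ) {u v : ℝ × ℝ} (p : (Gd n).Walk u v) : Prop :=
  p.IsPath ∧ ∀ x, x ∈ p.support ↔ (x ∈ V n ∧ x ≠ b n)

/-- `g2 n x`: the number of Hamiltonian paths of `SG n - b n` with end-vertex set `{o, x}` -/
def g2 (n : ℕ) (x : ℝ × ℝ) : ℕ := Nat.card {p : (Gd n).Walk o x // IsHamPathD n p}

/-- `g1 n`: the number of Hamiltonian paths of `SG n - b n` with end-vertex set `{o, a n}` -/
def g1 (n : ℕ) : ℕ := g2 n (a n)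

/-- the distribution ratio `G₂(n,x) = g₂(n,x)/g₁(n)` -/
def G2 (n : ℕ) (x : ℝ × ℝ) : ℝ := (g2 n x : ℝ) / (g1 n : ℝ)

/-- mid-side vertex `a_{m,1} = (3·2^(m-1), 0)` -/
def a1 (m : ℕ) : ℝ × ℝ := (3 * (2:ℝ) ^ m / 2, 0)

/-- mid-side vertex `b_{m,1} = (5·2^(m-2), 2^(m-2)·√3)` -/
def b1 (m : ℕ) : ℝ × ℝ := (5 * (2:ℝ) ^ m / 4, (2:ℝ) ^ m / 4 * sq3)

/-- mid-side vertex `c_{m,1} = (7·2^(m-2), 2^(m-2)·√3)` -/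
def c1 (m : ℕ) : ℝ × ℝ := (7 * (2:ℝ) ^ m / 4, (2:ℝ) ^ m / 4 * sq3)

/-- mid-side vertex `a_{m,2} = (2^m, 2^(m-1)·√3)` -/
def a2 (m : ℕ) : ℝ × ℝ := ((2:ℝ) ^ m, (2:ℝ) ^ m / 2 * sq3)

/-- mid-side vertex `b_{m,2} = (3·2^(m-2), 3·2^(m-2)·√3)` -/
def b2 (m : ℕ) : ℝ × ℝ := (3 * (2:ℝ) ^ m / 4, 3 * (2:ℝ) ^ m / 4 * sq3)

/-- mid-side vertex `c_{m,2} = (5·2^(m-2), 3·2^(m-2)·√3)` -/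
def c2 (m : ℕ) : ℝ × ℝ := (5 * (2:ℝ) ^ m / 4, 3 * (2:ℝ) ^ m / 4 * sq3)

/-- exceptional vertex `a* = (2^(n-1), (2^(n-1)-1)·√3)` -/
def astar (n : ℕ) : ℝ × ℝ := ((2:ℝ) ^ n / 2, ((2:ℝ) ^ n / 2 - 1) * sq3)

/-- exceptional vertex `b* = (2^(n-1) - 1/2, (2^n-1)·√3/2)` -/
def bstar (n : ℕ) : ℝ × ℝ := ((2:ℝ) ^ n / 2 - 1/2, ((2:ℝ) ^ n - 1) * sq3 / 2)

/-- exceptional vertex `c* = (2^(n-1) + 1/2, (2^n-1)·√3/2)` -/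
def cstar (n : ℕ) : ℝ × ℝ := ((2:ℝ) ^ n / 2 + 1/2, ((2:ℝ) ^ n - 1) * sq3 / 2)

/-- the Euclidean norm on `ℝ × ℝ` -/
def enorm (x : ℝ × ℝ) : ℝ := Real.sqrt (x.1 ^ 2 + x.2 ^ 2)

/-- the set `C n` of corner vertices of `SG n` -/
def C (n : ℕ) : Finset (ℝ × ℝ) :=
  ((Finset.range (n + 1)).image a) ∪ ((Finset.range (n + 1)).image b) ∪
    ((Finset.range n).image c)

/-- the mean `ℓ` displacement over the corner vertices -/
def xi' (n : ℕ) (ℓ : ℝ) : ℝ :=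
  (∑ x ∈ C n, enorm x ^ ℓ * F n x) / (∑ x ∈ C n, F n x)

/-- `p(n,x)`: the probability that a Hamiltonian path with one end at `o`
has its other end at `x` -/
def p (n : ℕ) (x : ℝ × ℝ) : ℝ := (f n o x : ℝ) / (H0 n : ℝ)

/-- the mean `ℓ` displacement of Hamiltonian paths on `SG n` with one end at `o` -/
def xi (n : ℕ) (ℓ : ℝ) : ℝ :=
  ∑ᶠ x ∈ {x : ℝ × ℝ | x ∈ V n ∧ x ≠ o}, enorm x ^ ℓ * p n x

/-- the partition function of Hamiltonian paths on `SG n` -/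
def Z (n : ℕ) (β : ℝ) : ℝ := (H n : ℝ) * Real.exp (-(β * ((3 ^ (n + 1) + 1) / 2)))


/-! ### Partition codes for the three corners -/

/-- `cornerRel q` is the equivalence relation on the three corners encoded by `q`: `0` is the
one-block partition, `4` the discrete one, and `i + 1` the one isolating the corner `i`. -/
def cornerRel (q : Fin 5) (i j : Fin 3) : Bool :=
  i == j || (q.val != 4 && q.val != i.val + 1 && q.val != j.val + 1)

/-- the number of blocks of the partition encoded by `q` -/
def blocks (q : Fin 5) : ℕ := if q.val = 0 then 1 else if q.val = 4 then 3 else 2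

/-- Corner `j` of copy `i` is the node `(i, j)`; it is identified with the node `(j, i)`. -/
def link (q : Fin 3 → Fin 5) (x y : Fin 3 × Fin 3) : Bool :=
  (x.1 == y.1 && cornerRel (q x.1) x.2 y.2) || (x.1 == y.2 && x.2 == y.1)

/-- connectivity between nodes when the copies have corner partitions `q` -/
def Joined (q : Fin 3 → Fin 5) : Fin 3 × Fin 3 → Fin 3 × Fin 3 → Prop :=
  Relation.ReflTransGen fun x y => link q x y = true

/-- the corner partitions `q` of the copies induce the partition `r` of the outer corners,
and every node is joined to an outer corner -/
def Induces (q : Fin 3 → Fin 5) (r : Fin 5) : Prop :=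
  (∀ i j, Joined q (i, i) (j, j) ↔ cornerRel r i j = true) ∧ ∀ x, ∃ i, Joined q (i, i) x

theorem exists_cornerRel (R : Fin 3 → Fin 3 → Prop) (hR : Equivalence R) :
    ∃ q, ∀ i j, R i j ↔ cornerRel q i j = true := by
  have r := hR.refl
  have s : ∀ i j, R i j ↔ R j i := fun i j => ⟨hR.symm, hR.symm⟩
  have t : ∀ i j k, R i j → R j k → R i k := fun i j k => hR.trans
  by_cases h01 : R 0 1 <;> by_cases h02 : R 0 2 <;> by_cases h12 : R 1 2
  · exact ⟨0, by simp [Fin.forall_fin_succ, cornerRel, r, s 1 0, s 2 0, s 2 1, h01, h02, h12]⟩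
  · exact absurd (t 1 0 2 ((s 0 1).1 h01) h02) h12
  · exact absurd (t 0 1 2 h01 h12) h02
  · exact ⟨3, by simp [Fin.forall_fin_succ, cornerRel, r, s 1 0, s 2 0, s 2 1, h01, h02, h12]⟩
  · exact absurd (t 0 2 1 h02 ((s 1 2).1 h12)) h01
  · exact ⟨2, by simp [Fin.forall_fin_succ, cornerRel, r, s 1 0, s 2 0, s 2 1, h01, h02, h12]⟩
  · exact ⟨1, by simp [Fin.forall_fin_succ, cornerRel, r, s 1 0, s 2 0, s 2 1, h01, h02, h12]⟩
  · exact ⟨4, by simp [Fin.forall_fin_succ, cornerRel, r, s 1 0, s 2 0, s 2 1, h01, h02, h12]⟩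

theorem cornerRel_injective {q r : Fin 5} (h : ∀ i j, cornerRel q i j = cornerRel r i j) :
    q = r := by
  revert q r; decide

/-- the nodes directly linked to a node of `L` -/
def linkStep (q : Fin 3 → Fin 5) (L : List (Fin 3 × Fin 3)) : List (Fin 3 × Fin 3) :=
  (List.finRange 3 ×ˢ List.finRange 3).filter fun y => L.any fun x => link q x y

/-- the nodes joined to the outer corner `i` -/
def reach (q : Fin 3 → Fin 5) (i : Fin 3) : List (Fin 3 × Fin 3) :=
  (linkStep q)^[6] [(i, i)]

theorem linkStep_reach (q0 q1 q2 : Fin 5) (i : Fin 3) :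
    (i, i) ∈ reach ![q0, q1, q2] i ∧
      linkStep ![q0, q1, q2] (reach ![q0, q1, q2] i) = reach ![q0, q1, q2] i := by
  revert q0 q1 q2 i
  decide +kernel

theorem joined_iff_mem_reach (q : Fin 3 → Fin 5) (i : Fin 3) (x : Fin 3 × Fin 3) :
    Joined q (i, i) x ↔ x ∈ reach q i := by
  have hq : ![q 0, q 1, q 2] = q := by ext j; fin_cases j <;> rfl
  constructor
  · intro h
    obtain ⟨h0, h1⟩ := linkStep_reach (q 0) (q 1) (q 2) i
    rw [hq] at h0 h1
    induction h with
    | refl => exact h0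
    | @tail y z _ hyz ih =>
      rw [← h1, linkStep, List.mem_filter]
      exact ⟨List.pair_mem_product.2 ⟨List.mem_finRange _, List.mem_finRange _⟩, List.any_eq_true.2 ⟨y, ih, hyz⟩⟩
  · have key : ∀ m, ∀ x ∈ (linkStep q)^[m] [(i, i)], Joined q (i, i) x := by
      intro m
      induction m with
      | zero =>
        intro x hx
        rw [Function.iterate_zero, id, List.mem_singleton] at hx
        rw [hx]
        exact Relation.ReflTransGen.refl
      | succ m ih =>
        intro x hx
        rw [Function.iterate_succ_apply', linkStep, List.mem_filter] at hx
        obtain ⟨y, hy, hyx⟩ := List.any_eq_true.1 hx.2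
        exact (ih y hy).tail hyx
    exact key 6 x

/-- decision procedure for `Induces` -/
def inducesBool (q : Fin 3 → Fin 5) (r : Fin 5) : Bool :=
  ((List.finRange 3).all fun i => (List.finRange 3).all fun j =>
    decide ((j, j) ∈ reach q i) == cornerRel r i j) &&
  (List.finRange 3 ×ˢ List.finRange 3).all fun x => (List.finRange 3).any fun i =>
    decide (x ∈ reach q i)

theorem induces_iff (q : Fin 3 → Fin 5) (r : Fin 5) : Induces q r ↔ inducesBool q r = true := by
  have hx : ∀ x : Fin 3 × Fin 3, x ∈ List.finRange 3 ×ˢ List.finRange 3 := fun _ =>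
    List.pair_mem_product.2 ⟨List.mem_finRange _, List.mem_finRange _⟩
  simp only [Induces, inducesBool, joined_iff_mem_reach, Bool.and_eq_true, List.all_eq_true,
    List.any_eq_true, hx, List.mem_finRange, true_and, forall_const, beq_iff_eq,
    decide_eq_true_eq]
  exact and_congr_left fun _ => forall₂_congr fun i j => by
    cases cornerRel r i j <;> simp

/-- the triples of corner partitions of the copies which induce `r` without closing a cycle -/
def glueTable (r : Fin 5) : List (Fin 5 × Fin 5 × Fin 5) :=
  match r with
  | 0 => [(0, 0, 1), (0, 0, 2), (0, 1, 0), (0, 3, 0), (2, 0, 0), (3, 0, 0)]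
  | 1 => [(0, 1, 1), (1, 0, 1), (1, 0, 2), (1, 1, 0), (1, 3, 0), (2, 0, 1), (3, 1, 0), (4, 0, 0)]
  | 2 => [(0, 1, 2), (0, 2, 1), (0, 2, 2), (0, 4, 0), (2, 0, 2), (2, 2, 0), (2, 3, 0), (3, 2, 0)]
  | 3 => [(0, 0, 4), (0, 1, 3), (0, 3, 1), (0, 3, 3), (2, 0, 3), (3, 0, 2), (3, 0, 3), (3, 3, 0)]
  | 4 => [(0, 1, 4), (0, 2, 4), (0, 4, 1), (0, 4, 3), (1, 0, 4), (1, 1, 2), (1, 1, 3), (1, 2, 1),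
      (1, 2, 2), (1, 3, 1), (1, 3, 3), (1, 4, 0), (2, 0, 4), (2, 2, 1), (2, 2, 3), (2, 3, 1),
      (2, 3, 3), (3, 1, 2), (3, 1, 3), (3, 2, 2), (3, 2, 3), (3, 4, 0), (4, 0, 2), (4, 0, 3),
      (4, 2, 0), (4, 3, 0)]

theorem inducesBool_table : ∀ q0 q1 q2 r : Fin 5, inducesBool ![q0, q1, q2] r = true →
    (blocks q0 + blocks q1 + blocks q2 ≤ blocks r + 3 ∧
      (blocks q0 + blocks q1 + blocks q2 = blocks r + 3 → (q0, q1, q2) ∈ glueTable r)) := by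
  decide +kernel

theorem table_inducesBool : ∀ r : Fin 5, ∀ x ∈ glueTable r,
    inducesBool ![x.1, x.2.1, x.2.2] r = true ∧
      blocks x.1 + blocks x.2.1 + blocks x.2.2 = blocks r + 3 := by
  decide +kernel

theorem Induces.blocks_le {q : Fin 3 → Fin 5} {r : Fin 5} (h : Induces q r) :
    ∑ i, blocks (q i) ≤ blocks r + 3 := by
  have hq : ![q 0, q 1, q 2] = q := by ext j; fin_cases j <;> rfl
  rw [Fin.sum_univ_three]
  exact (inducesBool_table (q 0) (q 1) (q 2) r (by rwa [hq, ← induces_iff])).1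

theorem induces_and_blocks_iff (q : Fin 3 → Fin 5) (r : Fin 5) :
    (Induces q r ∧ ∑ i, blocks (q i) = blocks r + 3) ↔ (q 0, q 1, q 2) ∈ glueTable r := by
  have hq : ![q 0, q 1, q 2] = q := by ext j; fin_cases j <;> rfl
  rw [Fin.sum_univ_three, induces_iff]
  constructor
  · rintro ⟨h, h'⟩
    exact (inducesBool_table (q 0) (q 1) (q 2) r (by rwa [hq])).2 h'
  · intro h
    have := table_inducesBool r _ h
    simpa only [hq] using this

/-! ### Edge sets and their states -/

section EdgeSets

variable {α : Type*} [DecidableEq α]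

/-- connectivity through the edges of `S` -/
def Conn (S : Finset (Sym2 α)) : α → α → Prop := Relation.ReflTransGen fun x y => s(x, y) ∈ S

/-- the number of edges of `S` at `v` -/
def deg (S : Finset (Sym2 α)) (v : α) : ℕ := (S.filter fun e => v ∈ e).card

/-- the edges of `S` are not loops and have both ends in `W` -/
def Supported (W : Finset α) (S : Finset (Sym2 α)) : Prop :=
  ∀ e ∈ S, ¬e.IsDiag ∧ ∀ v ∈ e, v ∈ W

omit [DecidableEq α] in
theorem Supported.mono {W : Finset α} {S T : Finset (Sym2 α)} (hT : Supported W T)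
    (h : S ⊆ T) : Supported W S := fun e he => hT e (h he)

omit [DecidableEq α] in
theorem conn_equivalence (S : Finset (Sym2 α)) : Equivalence (Conn S) where
  refl _ := Relation.ReflTransGen.refl
  symm h := by
    induction h with
    | refl => exact Relation.ReflTransGen.refl
    | tail _ hyz ih => exact ih.head (by rwa [Sym2.eq_swap])
  trans h h' := h.trans h'

omit [DecidableEq α] in
theorem Conn.mono {S T : Finset (Sym2 α)} (h : S ⊆ T) {x y : α} (hxy : Conn S x y) :
    Conn T x y :=
  Relation.ReflTransGen.mono (fun _ _ hab => h hab) _ _ hxy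

omit [DecidableEq α] in
theorem Supported.mem_of_conn {W : Finset α} {S : Finset (Sym2 α)} (hS : Supported W S)
    {x y : α} (h : Conn S x y) (hx : x ∈ W) : y ∈ W := by
  induction h with
  | refl => exact hx
  | tail _ hyz _ => exact (hS _ hyz).2 _ (Sym2.mem_mk_right _ _)

theorem Supported.deg_eq_zero {W : Finset α} {S : Finset (Sym2 α)} (hS : Supported W S)
    {v : α} (hv : v ∉ W) : deg S v = 0 := by
  rw [deg, Finset.card_eq_zero, Finset.filter_eq_empty_iff]
  exact fun e he hve => hv ((hS e he).2 v hve)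

/-- the handshake identity -/
theorem Supported.sum_deg {W : Finset α} {S : Finset (Sym2 α)} (hS : Supported W S) :
    ∑ v ∈ W, deg S v = 2 * S.card := by
  have h := Finset.sum_card_bipartiteAbove_eq_sum_card_bipartiteBelow (s := W) (t := S)
    (fun v e => v ∈ e)
  simp only [Finset.bipartiteAbove, Finset.bipartiteBelow] at h
  simp only [deg]
  rw [h, Finset.sum_const_nat (m := 2), mul_comm]
  intro e he
  obtain ⟨hd, hm⟩ := hS e he
  induction e using Sym2.ind with
  | _ x y =>
    rw [Sym2.mk_isDiag_iff] at hd
    have : W.filter (fun v => v ∈ s(x, y)) = {x, y} := by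
      ext v
      simp only [Finset.mem_filter, Sym2.mem_iff, Finset.mem_insert, Finset.mem_singleton]
      refine ⟨fun h => h.2, fun h => ⟨hm v (Sym2.mem_iff.2 h), h⟩⟩
    rw [this, Finset.card_pair hd]

/-- Degrees and connectivity of the three corners. -/
abbrev St := (ℕ × ℕ × ℕ) × Fin 5

/-- the degree of the corner `i` -/
def cornerDeg (t : St) : Fin 3 → ℕ := ![t.1.1, t.1.2.1, t.1.2.2]

/-- `S` is a spanning linear forest of `W`, each of whose components contains a corner,
with corner degrees and corner connectivity given by `t`. -/
structure HasState (W : Finset α) (c : Fin 3 → α) (S : Finset (Sym2 α)) (t : St) : Prop where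
  deg_le : ∀ v ∈ W, deg S v ≤ 2
  exists_conn : ∀ v ∈ W, ∃ i, Conn S (c i) v
  deg_eq : ∀ i, deg S (c i) = cornerDeg t i
  conn_iff : ∀ i j, Conn S (c i) (c j) ↔ cornerRel t.2 i j = true
  card_eq : W.card = S.card + blocks t.2

theorem HasState.unique {W : Finset α} {c : Fin 3 → α} {S : Finset (Sym2 α)} {t t' : St}
    (h : HasState W c S t) (h' : HasState W c S t') : t = t' := by
  have h1 := fun i => (h.deg_eq i).symm.trans (h'.deg_eq i)
  have h2 : t.2 = t'.2 := cornerRel_injective fun i j => by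
    rw [Bool.eq_iff_iff, ← h.conn_iff, h'.conn_iff]
  exact Prod.ext (Prod.ext (h1 0) (Prod.ext (h1 1) (h1 2))) h2

/-! ### Gluing three copies -/

/-- The sets `W i` pairwise meet in one point, corner `j` of `W i` being corner `i` of `W j`. -/
structure IsGluing (W : Fin 3 → Finset α) (c : Fin 3 → Fin 3 → α) : Prop where
  symm : ∀ i j, c i j = c j i
  mem : ∀ i j, c i j ∈ W i
  inj : ∀ i, Function.Injective (c i)
  inter : ∀ i j v, i ≠ j → v ∈ W i → v ∈ W j → v = c i j

namespace IsGluing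

variable {W : Fin 3 → Finset α} {c : Fin 3 → Fin 3 → α} (hG : IsGluing W c)
include hG

omit [DecidableEq α] in
theorem notMem {i j k : Fin 3} (hi : k ≠ i) (hj : k ≠ j) : c i j ∉ W k := by
  intro h
  have h1 := hG.inter k i _ hi h (hG.mem i j)
  rw [hG.symm k i] at h1
  exact hj (hG.inj i h1).symm

theorem card_biUnion : (Finset.univ.biUnion W).card + 3 = ∑ i, (W i).card := by
  have hU : Finset.univ.biUnion W = (W 0 ∪ W 1) ∪ W 2 := by
    ext v; simp [Fin.exists_fin_succ]
  have hI : W 0 ∩ W 1 = {c 0 1} := by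
    ext v
    rw [Finset.mem_inter, Finset.mem_singleton]
    refine ⟨fun h => hG.inter 0 1 v (by decide) h.1 h.2, ?_⟩
    rintro rfl
    exact ⟨hG.mem 0 1, hG.symm 0 1 ▸ hG.mem 1 0⟩
  have hJ : (W 0 ∪ W 1) ∩ W 2 = {c 2 0, c 2 1} := by
    ext v
    rw [Finset.mem_inter, Finset.mem_union, Finset.mem_insert, Finset.mem_singleton]
    constructor
    · rintro ⟨h | h, h'⟩
      · exact Or.inl (hG.inter 2 0 v (by decide) h' h)
      · exact Or.inr (hG.inter 2 1 v (by decide) h' h)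
    · rintro (rfl | rfl)
      · exact ⟨Or.inl (hG.symm 2 0 ▸ hG.mem 0 2), hG.mem 2 0⟩
      · exact ⟨Or.inr (hG.symm 2 1 ▸ hG.mem 1 2), hG.mem 2 1⟩
  have h1 := Finset.card_union_add_card_inter (W 0) (W 1)
  have h2 := Finset.card_union_add_card_inter (W 0 ∪ W 1) (W 2)
  rw [hI, Finset.card_singleton] at h1
  rw [hJ, Finset.card_pair (fun h => absurd (hG.inj 2 h) (by decide))] at h2
  rw [hU, Fin.sum_univ_three]
  omega

variable {S : Fin 3 → Finset (Sym2 α)} (hS : ∀ i, Supported (W i) (S i))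
include hS

omit [DecidableEq α] in
theorem disjoint {i j : Fin 3} (hij : i ≠ j) : Disjoint (S i) (S j) := by
  rw [Finset.disjoint_left]
  intro e hi hj
  obtain ⟨hd, hm⟩ := hS i e hi
  obtain ⟨-, hm'⟩ := hS j e hj
  induction e using Sym2.ind with
  | _ x y =>
    apply hd
    rw [Sym2.mk_isDiag_iff, hG.inter i j x hij (hm x (Sym2.mem_mk_left _ _))
      (hm' x (Sym2.mem_mk_left _ _)), hG.inter i j y hij (hm y (Sym2.mem_mk_right _ _))
      (hm' y (Sym2.mem_mk_right _ _))]

theorem card_edges : (Finset.univ.biUnion S).card = ∑ i, (S i).card :=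
  Finset.card_biUnion fun _ _ _ _ hij => hG.disjoint hS hij

theorem deg_biUnion (v : α) : deg (Finset.univ.biUnion S) v = ∑ i, deg (S i) v := by
  rw [deg, Finset.filter_biUnion, Finset.card_biUnion]
  · rfl
  · exact fun i _ j _ hij => Finset.disjoint_filter_filter (hG.disjoint hS hij)

theorem deg_outer (i : Fin 3) : deg (Finset.univ.biUnion S) (c i i) = deg (S i) (c i i) := by
  rw [hG.deg_biUnion hS, Fintype.sum_eq_single i]
  exact fun j hj => (hS j).deg_eq_zero (hG.notMem hj hj)

theorem deg_inner {i j : Fin 3} (hij : i ≠ j) :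
    deg (Finset.univ.biUnion S) (c i j) = deg (S i) (c i j) + deg (S j) (c j i) := by
  rw [hG.deg_biUnion hS, Fintype.sum_eq_add i j hij, hG.symm j i]
  exact fun k hk => (hS k).deg_eq_zero (hG.notMem hk.1 hk.2)

theorem deg_le_iff : (∀ v ∈ Finset.univ.biUnion W, deg (Finset.univ.biUnion S) v ≤ 2) ↔
    (∀ i, ∀ v ∈ W i, deg (S i) v ≤ 2) ∧
      ∀ i j, i ≠ j → deg (S i) (c i j) + deg (S j) (c j i) ≤ 2 := by
  constructor
  · refine fun h => ⟨fun i v hv => ?_, fun i j hij => ?_⟩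
    · refine le_trans ?_ (h v (Finset.mem_biUnion.2 ⟨i, Finset.mem_univ i, hv⟩))
      rw [hG.deg_biUnion hS]
      exact Finset.single_le_sum (f := fun i => deg (S i) v) (fun _ _ => Nat.zero_le _)
        (Finset.mem_univ i)
    · rw [← hG.deg_inner hS hij]
      exact h _ (Finset.mem_biUnion.2 ⟨i, Finset.mem_univ i, hG.mem i j⟩)
  · rintro ⟨h1, h2⟩ v hv
    obtain ⟨i, -, hi⟩ := Finset.mem_biUnion.1 hv
    by_cases hj : ∃ j, i ≠ j ∧ v ∈ W j
    · obtain ⟨j, hij, hj⟩ := hj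
      rw [hG.inter i j v hij hi hj, hG.deg_inner hS hij]
      exact h2 i j hij
    · push Not at hj
      rw [hG.deg_biUnion hS, Fintype.sum_eq_single i]
      · exact h1 i v hi
      · exact fun j hji => (hS j).deg_eq_zero (hj j hji.symm)

variable {q : Fin 3 → Fin 5}
  (hq : ∀ i j k, Conn (S i) (c i j) (c i k) ↔ cornerRel (q i) j k = true)
include hq

theorem exists_joined_of_conn {x : Fin 3 × Fin 3} {v : α}
    (h : Conn (Finset.univ.biUnion S) (c x.1 x.2) v) :
    ∀ i, v ∈ W i → ∃ j, Joined q x (i, j) ∧ Conn (S i) (c i j) v := by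
  induction h with
  | refl =>
    intro i hi
    by_cases h1 : i = x.1
    · subst h1
      exact ⟨x.2, Relation.ReflTransGen.refl, Relation.ReflTransGen.refl⟩
    · have h2 : i = x.2 := by
        by_contra h2
        exact hG.notMem h1 h2 hi
      subst h2
      refine ⟨x.1, Relation.ReflTransGen.single ?_, ?_⟩
      · simp [link]
      · rw [hG.symm]; exact Relation.ReflTransGen.refl
  | @tail y z _ hyz ih =>
    intro i hi
    obtain ⟨k, -, hk⟩ := Finset.mem_biUnion.1 hyz
    obtain ⟨j, hj, hjy⟩ := ih k ((hS k _ hk).2 y (Sym2.mem_mk_left _ _))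
    have hjz : Conn (S k) (c k j) z := hjy.tail hk
    by_cases hki : k = i
    · subst hki
      exact ⟨j, hj, hjz⟩
    · have hz := hG.inter k i z hki ((hS k _ hk).2 z (Sym2.mem_mk_right _ _)) hi
      subst hz
      refine ⟨k, (hj.tail (b := (k, j)) (c := (k, i)) ?_).tail ?_, ?_⟩
      · simp [link, (hq k j i).1 hjz]
      · simp [link]
      · rw [hG.symm]; exact Relation.ReflTransGen.refl

omit hS in
theorem conn_of_joined {x y : Fin 3 × Fin 3} (h : Joined q x y) :
    Conn (Finset.univ.biUnion S) (c x.1 x.2) (c y.1 y.2) := by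
  induction h with
  | refl => exact Relation.ReflTransGen.refl
  | @tail y z _ hyz ih =>
    refine ih.trans ?_
    simp only [link, Bool.or_eq_true, Bool.and_eq_true, beq_iff_eq] at hyz
    obtain ⟨h1, h2⟩ | ⟨h1, h2⟩ := hyz
    · rw [← hq, h1] at h2
      rw [h1]
      exact Conn.mono (Finset.subset_biUnion_of_mem S (Finset.mem_univ z.1)) h2
    · rw [h1, h2, hG.symm]

theorem conn_node_iff (x y : Fin 3 × Fin 3) :
    Conn (Finset.univ.biUnion S) (c x.1 x.2) (c y.1 y.2) ↔ Joined q x y := by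
  refine ⟨fun h => ?_, hG.conn_of_joined hq⟩
  obtain ⟨j, hj, hc⟩ := hG.exists_joined_of_conn hS hq h y.1 (hG.mem _ _)
  exact hj.tail (by simp [link, (hq _ _ _).1 hc])

theorem exists_conn_iff :
    (∀ v ∈ Finset.univ.biUnion W, ∃ i, Conn (Finset.univ.biUnion S) (c i i) v) ↔
      (∀ i, ∀ v ∈ W i, ∃ j, Conn (S i) (c i j) v) ∧ ∀ x, ∃ i, Joined q (i, i) x := by
  constructor
  · refine fun h => ⟨fun i v hv => ?_, fun x => ?_⟩
    · obtain ⟨k, hk⟩ := h v (Finset.mem_biUnion.2 ⟨i, Finset.mem_univ i, hv⟩)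
      obtain ⟨j, -, hj⟩ := hG.exists_joined_of_conn hS hq (x := (k, k)) hk i hv
      exact ⟨j, hj⟩
    · obtain ⟨k, hk⟩ := h (c x.1 x.2) (Finset.mem_biUnion.2 ⟨x.1, Finset.mem_univ _, hG.mem _ _⟩)
      exact ⟨k, (hG.conn_node_iff hS hq (k, k) x).1 hk⟩
  · rintro ⟨h1, h2⟩ v hv
    obtain ⟨i, -, hi⟩ := Finset.mem_biUnion.1 hv
    obtain ⟨j, hj⟩ := h1 i v hi
    obtain ⟨k, hk⟩ := h2 (i, j)
    exact ⟨k, (hG.conn_of_joined hq hk).trans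
      (Conn.mono (Finset.subset_biUnion_of_mem S (Finset.mem_univ i)) hj)⟩

end IsGluing

/-- Every spanning edge set has at least `|W|` minus the number of components edges, for
edge sets all of whose components contain a corner. -/
def EdgeBound (W : Finset α) (c : Fin 3 → α) (S : Finset (Sym2 α)) : Prop :=
  ∀ q, (∀ v ∈ W, ∃ i, Conn S (c i) v) → (∀ i j, Conn S (c i) (c j) ↔ cornerRel q i j = true) →
    W.card ≤ S.card + blocks q

theorem IsGluing.edgeBound {W : Fin 3 → Finset α} {c : Fin 3 → Fin 3 → α} (hG : IsGluing W c)
    {S : Fin 3 → Finset (Sym2 α)} (hS : ∀ i, Supported (W i) (S i))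
    (hB : ∀ i, EdgeBound (W i) (c i) (S i)) :
    EdgeBound (Finset.univ.biUnion W) (fun i => c i i) (Finset.univ.biUnion S) := by
  intro r h1 h2
  choose q hq using fun i => exists_cornerRel (fun j k => Conn (S i) (c i j) (c i k))
    ⟨fun _ => (conn_equivalence _).refl _, (conn_equivalence _).symm, (conn_equivalence _).trans⟩
  obtain ⟨h3, h4⟩ := (hG.exists_conn_iff hS hq).1 h1
  have hI : Induces q r := ⟨fun i j => by rw [← h2, ← hG.conn_node_iff hS hq], h4⟩
  have h5 := Finset.sum_le_sum fun i (_ : i ∈ Finset.univ) => hB i (q i) (h3 i) (hq i)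
  rw [Finset.sum_add_distrib] at h5
  have := hI.blocks_le
  have := hG.card_biUnion
  have := hG.card_edges hS
  omega

/-- the states `T` of the three copies glue to the state `t` -/
def Glues (T : Fin 3 → St) (t : St) : Prop :=
  (∀ i, cornerDeg (T i) i = cornerDeg t i) ∧
  (∀ i j, i ≠ j → cornerDeg (T i) j + cornerDeg (T j) i ≤ 2) ∧
  ((T 0).2, (T 1).2, (T 2).2) ∈ glueTable t.2

theorem IsGluing.hasState_iff {W : Fin 3 → Finset α} {c : Fin 3 → Fin 3 → α}
    (hG : IsGluing W c) {S : Fin 3 → Finset (Sym2 α)} (hS : ∀ i, Supported (W i) (S i))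
    (hB : ∀ i, EdgeBound (W i) (c i) (S i)) (t : St) :
    HasState (Finset.univ.biUnion W) (fun i => c i i) (Finset.univ.biUnion S) t ↔
      ∃ T : Fin 3 → St, (∀ i, HasState (W i) (c i) (S i) (T i)) ∧ Glues T t := by
  have hW := hG.card_biUnion
  have hC := hG.card_edges hS
  constructor
  · intro h
    choose q hq using fun i => exists_cornerRel (fun j k => Conn (S i) (c i j) (c i k))
      ⟨fun _ => (conn_equivalence _).refl _, (conn_equivalence _).symm, (conn_equivalence _).trans⟩
    obtain ⟨h3, h4⟩ := (hG.exists_conn_iff hS hq).1 h.exists_conn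
    obtain ⟨h5, h6⟩ := (hG.deg_le_iff hS).1 h.deg_le
    have hI : Induces q t.2 := ⟨fun i j => by rw [← h.conn_iff, ← hG.conn_node_iff hS hq], h4⟩
    have h7 := hI.blocks_le
    have h8 := h.card_eq
    have h9 : ∀ i, (W i).card ≤ (S i).card + blocks (q i) := fun i => hB i (q i) (h3 i) (hq i)
    have hd : ∀ i j, cornerDeg ((deg (S i) (c i 0), deg (S i) (c i 1), deg (S i) (c i 2)), q i) j
        = deg (S i) (c i j) := by
      intro i j
      fin_cases j <;> rfl
    rw [Fin.sum_univ_three] at hW hC h7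
    have h90 := h9 0
    have h91 := h9 1
    have h92 := h9 2
    refine ⟨fun i => ((deg (S i) (c i 0), deg (S i) (c i 1), deg (S i) (c i 2)), q i),
      fun i => ⟨h5 i, h3 i, fun j => (hd i j).symm, hq i, ?_⟩, fun i => ?_, fun i j hij => ?_, ?_⟩
    · fin_cases i <;> simp only [Fin.zero_eta, Fin.mk_one, Fin.reduceFinMk] <;> omega
    · rw [hd, ← h.deg_eq, hG.deg_outer hS]
    · rw [hd, hd]
      exact h6 i j hij
    · refine (induces_and_blocks_iff q t.2).1 ⟨hI, ?_⟩
      rw [Fin.sum_univ_three]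
      omega
  · rintro ⟨T, hT, h1, h2, h3⟩
    obtain ⟨hI, hb⟩ := (induces_and_blocks_iff (fun i => (T i).2) t.2).2 h3
    have hq := fun i => (hT i).conn_iff
    refine ⟨(hG.deg_le_iff hS).2 ⟨fun i => (hT i).deg_le, fun i j hij => ?_⟩,
      (hG.exists_conn_iff hS hq).2 ⟨fun i => (hT i).exists_conn, hI.2⟩, fun i => ?_,
      fun i j => ?_, ?_⟩
    · rw [(hT i).deg_eq, (hT j).deg_eq]
      exact h2 i j hij
    · rw [hG.deg_outer hS, (hT i).deg_eq, h1]
    · rw [← hI.1, ← hG.conn_node_iff hS hq]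
    · have h4 := Finset.sum_congr rfl fun i (_ : i ∈ Finset.univ) => (hT i).card_eq
      rw [Finset.sum_add_distrib] at h4
      omega

end EdgeSets

/-! ### The states which can occur -/

/-- `x` has degrees at most `2`, every corner of degree `0` is isolated, and at most two of the
missing degrees are missing at vertices other than the corners. -/
def okState (x : St) : Bool :=
  ((List.finRange 3).all fun i => decide (cornerDeg x i ≤ 2)) &&
  ((List.finRange 3).all fun i => (List.finRange 3).all fun j =>
    i == j || !cornerRel x.2 i j || cornerDeg x i != 0) &&
  decide (6 ≤ 2 * blocks x.2 + (x.1.1 + x.1.2.1 + x.1.2.2)) &&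
  decide (2 * blocks x.2 + (x.1.1 + x.1.2.1 + x.1.2.2) ≤ 8)

/-- the list of all `x` with `okState x` -/
def states : List St :=
  (([0, 1, 2] ×ˢ [0, 1, 2] ×ˢ [0, 1, 2]) ×ˢ List.finRange 5).filter okState

/-- the triples of elements of `states` which glue to `t` -/
def glueList (t : St) : List (St × St × St) :=
  (glueTable t.2).flatMap fun q =>
  (states.filter fun x => x.2 == q.1 && x.1.1 == t.1.1).flatMap fun x =>
  (states.filter fun y => y.2 == q.2.1 && y.1.2.1 == t.1.2.1 &&
    decide (x.1.2.1 + y.1.1 ≤ 2)).flatMap fun y =>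
  (states.filter fun z => z.2 == q.2.2 && z.1.2.2 == t.1.2.2 &&
    decide (x.1.2.2 + z.1.1 ≤ 2) && decide (y.1.2.2 + z.1.2.1 ≤ 2)).map fun z => (x, y, z)

/-- A coarse type of `x`, which turns out to determine the number of edge sets with state `x`.
The type `10` is that of the states which do not contribute. -/
def cls (x : St) : Fin 11 :=
  match x.1.1 ^ 2 + x.1.2.1 ^ 2 + x.1.2.2 ^ 2, blocks x.2 with
  | 0, _ => 0
  | 1, _ => 5
  | 2, 2 => 2
  | 2, _ => 8
  | 3, _ => 6
  | 5, _ => 4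
  | 6, 1 => 1
  | 6, _ => if (List.finRange 3).any fun i => x.2.val == i.val + 1 && cornerDeg x i == 2
      then 10 else 7
  | 9, _ => 3
  | 12, _ => 9
  | _, _ => 10

/-- The entry `(m, i, j, k)` of `poly l` stands for the term `m * vᵢ * vⱼ * vₖ` in the recursion
for the number `vₗ` of edge sets with a given state of type `l`. -/
def poly (k : Fin 11) : List (ℕ × Fin 11 × Fin 11 × Fin 11) :=
  match k with
  | 1 => [(2, 1, 1, 2)]
  | 2 => [(1, 0, 1, 1), (2, 1, 2, 2)]
  | 3 => [(2, 1, 1, 2), (2, 1, 1, 4), (2, 1, 1, 6), (2, 1, 2, 3)]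
  | 4 => [(1, 0, 1, 1), (1, 0, 1, 3), (1, 1, 1, 5), (2, 1, 2, 2), (2, 1, 2, 4), (2, 1, 2, 6),
      (1, 2, 2, 3)]
  | 5 => [(2, 0, 1, 2), (2, 0, 1, 4), (2, 1, 2, 5), (2, 2, 2, 2), (2, 2, 2, 4), (2, 2, 2, 6)]
  | 6 => [(1, 1, 1, 5), (4, 1, 2, 2), (2, 1, 2, 4), (6, 1, 2, 6), (1, 2, 2, 3)]
  | 7 => [(1, 1, 1, 5), (1, 1, 1, 8), (1, 1, 2, 2), (4, 1, 2, 4), (4, 1, 2, 6), (4, 1, 2, 7),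
      (1, 1, 3, 5), (1, 1, 4, 4), (2, 1, 4, 6), (3, 1, 6, 6), (1, 2, 2, 3), (2, 2, 3, 4),
      (2, 2, 3, 6)]
  | 8 => [(4, 0, 1, 2), (4, 0, 1, 4), (4, 0, 1, 6), (4, 0, 1, 7), (2, 0, 2, 3), (2, 0, 3, 4),
      (8, 1, 2, 5), (4, 1, 2, 8), (4, 1, 4, 5), (4, 1, 5, 6), (2, 2, 2, 2), (4, 2, 2, 4),
      (8, 2, 2, 6), (4, 2, 2, 7), (2, 2, 3, 5), (2, 2, 4, 4), (4, 2, 4, 6), (6, 2, 6, 6)]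
  | 9 => [(6, 1, 1, 4), (6, 1, 1, 7), (6, 1, 3, 4)]
  | _ => []

/-- the number of edge sets of `SG n` with a given state of type `k` -/
def val : ℕ → Fin 11 → ℕ
  | 0, k => if k.val ≤ 2 then 1 else 0
  | n + 1, k => ((poly k).map fun m => m.1 * (val n m.2.1 * val n m.2.2.1 * val n m.2.2.2)).sum

/-- the monomial of a triple of types, up to order -/
def sortTriple (x : Fin 11 × Fin 11 × Fin 11) : Fin 11 × Fin 11 × Fin 11 :=
  (min x.1 (min x.2.1 x.2.2), max (min x.1 x.2.1) (min (max x.1 x.2.1) x.2.2),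
    max x.1 (max x.2.1 x.2.2))

theorem glueList_perm : ∀ t ∈ states, cls t ≠ 10 →
    ((glueList t).map fun T => sortTriple (cls T.1, cls T.2.1, cls T.2.2)).isPerm
      ((poly (cls t)).flatMap fun m => List.replicate m.1 m.2) = true := by
  decide +kernel

theorem mem_states {x : St} : x ∈ states ↔ okState x = true := by
  refine ⟨fun h => (List.mem_filter.1 h).2, fun h => List.mem_filter.2 ⟨?_, h⟩⟩
  simp only [okState, Bool.and_eq_true, List.all_eq_true, List.mem_finRange, forall_const,
    decide_eq_true_eq, Fin.forall_fin_succ] at h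
  have h0 : x.1.1 ≤ 2 := h.1.1.1.1
  have h1 : x.1.2.1 ≤ 2 := h.1.1.1.2.1
  have h2 : x.1.2.2 ≤ 2 := h.1.1.1.2.2.1
  obtain ⟨⟨d0, d1, d2⟩, q⟩ := x
  dsimp only at h0 h1 h2
  refine List.pair_mem_product.2 ⟨List.pair_mem_product.2 ⟨?_, List.pair_mem_product.2 ⟨?_, ?_⟩⟩,
    List.mem_finRange q⟩ <;> simp only [List.mem_cons, List.not_mem_nil, or_false] <;> omega

theorem glueTable_nodup (r : Fin 5) : (glueTable r).Nodup := by
  revert r; decide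

theorem states_nodup : states.Nodup := by
  refine List.Nodup.filter _ (List.Nodup.product (List.Nodup.product ?_
    (List.Nodup.product ?_ ?_)) (List.nodup_finRange 5)) <;> decide

theorem mem_glueList {t : St} {T : St × St × St} :
    T ∈ glueList t ↔ (T.1 ∈ states ∧ T.2.1 ∈ states ∧ T.2.2 ∈ states) ∧
      Glues ![T.1, T.2.1, T.2.2] t := by
  obtain ⟨x, y, z⟩ := T
  simp only [glueList, List.mem_flatMap, List.mem_filter, List.mem_map, Bool.and_eq_true,
    beq_iff_eq, decide_eq_true_eq, Prod.mk.injEq, Glues, Fin.forall_fin_succ, cornerDeg]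
  constructor
  · rintro ⟨⟨q0, q1, q2⟩, hq, x', ⟨hx, rfl, hx'⟩, y', ⟨hy, ⟨rfl, hy'⟩, h1⟩, z',
      ⟨hz, ⟨⟨rfl, hz'⟩, h2⟩, h3⟩, rfl, rfl, rfl⟩
    refine ⟨⟨hx, hy, hz⟩, ?_, ?_, hq⟩
    · simp_all
    · simp
      omega
  · rintro ⟨⟨hx, hy, hz⟩, h0, h1, hq⟩
    simp at h0 h1 hq
    exact ⟨(x.2, y.2, z.2), hq, x, ⟨hx, rfl, h0.1⟩, y, ⟨hy, ⟨rfl, h0.2.1⟩, by omega⟩, z,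
      ⟨hz, ⟨⟨rfl, h0.2.2⟩, by omega⟩, by omega⟩, rfl, rfl, rfl⟩

theorem glueList_nodup (t : St) : (glueList t).Nodup := by
  have key : ∀ (p : St → Bool), (states.filter p).Nodup := fun p => states_nodup.filter p
  rw [glueList, List.nodup_flatMap]
  refine ⟨fun q _ => ?_, (glueTable_nodup t.2).imp ?_⟩
  · rw [List.nodup_flatMap]
    refine ⟨fun x _ => ?_, (key _).imp ?_⟩
    · rw [List.nodup_flatMap]
      refine ⟨fun y _ => ?_, (key _).imp ?_⟩
      · exact (key _).map fun z z' h => by simpa using h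
      · intro y y' hne
        rw [Function.onFun, List.disjoint_left]
        intro T h h'
        obtain ⟨z, -, rfl⟩ := List.mem_map.1 h
        obtain ⟨z', -, h2⟩ := List.mem_map.1 h'
        simp only [Prod.mk.injEq, true_and] at h2
        exact hne h2.1.symm
    · intro x x' hne
      rw [Function.onFun, List.disjoint_left]
      intro T h h'
      simp only [List.mem_flatMap, List.mem_map] at h h'
      obtain ⟨y, -, z, -, rfl⟩ := h
      obtain ⟨y', -, z', -, h2⟩ := h'
      simp only [Prod.mk.injEq] at h2
      exact hne h2.1.symm
  · intro q q' hne
    rw [Function.onFun, List.disjoint_left]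
    intro T h h'
    simp only [List.mem_flatMap, List.mem_map, List.mem_filter, Bool.and_eq_true,
      beq_iff_eq] at h h'
    obtain ⟨x, hx, y, hy, z, hz, rfl⟩ := h
    obtain ⟨x', hx', y', hy', z', hz', h2⟩ := h'
    simp only [Prod.mk.injEq] at h2
    obtain ⟨rfl, rfl, rfl⟩ := h2
    apply hne
    rw [Prod.ext_iff, Prod.ext_iff, ← hx.2.1, ← hx'.2.1, ← hy.2.1.1, ← hy'.2.1.1, ← hz.2.1.1.1,
      ← hz'.2.1.1.1]
    exact ⟨rfl, rfl, rfl⟩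

section Counting

variable {α : Type*} [DecidableEq α]

theorem deg_pos_of_mem {S : Finset (Sym2 α)} {x y : α} (h : s(x, y) ∈ S) : 0 < deg S x :=
  Finset.card_pos.2 ⟨_, Finset.mem_filter.2 ⟨h, Sym2.mem_mk_left _ _⟩⟩

theorem Conn.deg_pos {S : Finset (Sym2 α)} {x y : α} (h : Conn S x y) (hxy : x ≠ y) :
    0 < deg S x := by
  obtain h | ⟨z, hz, -⟩ := Relation.ReflTransGen.cases_head h
  · exact absurd h hxy
  · exact deg_pos_of_mem hz

variable {W : Finset α} {c : Fin 3 → α} {S : Finset (Sym2 α)} {t : St}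

theorem HasState.cornerDeg_le (h : HasState W c S t) (hc : ∀ i, c i ∈ W) (i : Fin 3) :
    cornerDeg t i ≤ 2 := by
  rw [← h.deg_eq]
  exact h.deg_le _ (hc i)

theorem HasState.le_sum (h : HasState W c S t) (hS : Supported W S) (hc : ∀ i, c i ∈ W)
    (hi : Function.Injective c) : 6 ≤ 2 * blocks t.2 + ∑ i, cornerDeg t i := by
  have h1 : ∑ v ∈ Finset.univ.image c, (2 - deg S v) ≤ ∑ v ∈ W, (2 - deg S v) :=
    Finset.sum_le_sum_of_subset fun v hv => by
      obtain ⟨i, -, rfl⟩ := Finset.mem_image.1 hv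
      exact hc i
  rw [Finset.sum_image fun _ _ _ _ h => hi h] at h1
  have h2 : ∑ v ∈ W, (2 - deg S v) + ∑ v ∈ W, deg S v = 2 * W.card := by
    rw [← Finset.sum_add_distrib, Finset.sum_const_nat (m := 2), mul_comm]
    exact fun v hv => Nat.sub_add_cancel (h.deg_le v hv)
  rw [hS.sum_deg, h.card_eq] at h2
  simp only [h.deg_eq, Fin.sum_univ_three] at h1 ⊢
  omega

theorem HasState.okState (h : HasState W c S t) (hS : Supported W S) (hc : ∀ i, c i ∈ W)
    (hi : Function.Injective c) (hle : 2 * blocks t.2 + ∑ i, cornerDeg t i ≤ 8) :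
    okState t = true := by
  have h1 := h.cornerDeg_le hc
  have h2 := h.le_sum hS hc hi
  rw [Fin.sum_univ_three] at hle h2
  have h3 : ∀ i j, cornerRel t.2 i j = true → i ≠ j → cornerDeg t i ≠ 0 := fun i j hij hne => by
    rw [← h.deg_eq]
    exact (((h.conn_iff i j).2 hij).deg_pos fun he => hne (hi he)).ne'
  simp only [SierpinskiGasket.okState, Bool.and_eq_true, List.all_eq_true, decide_eq_true_eq,
    List.mem_finRange, forall_const, Bool.or_eq_true, beq_iff_eq, Bool.not_eq_true', bne_iff_ne]
  refine ⟨⟨⟨h1, fun i j => ?_⟩, h2⟩, hle⟩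
  by_cases hij : i = j
  · exact Or.inl (Or.inl hij)
  · cases hr : cornerRel t.2 i j
    · exact Or.inl (Or.inr rfl)
    · exact Or.inr (h3 i j hr hij)

theorem Glues.le_sum {T : Fin 3 → St} (h : Glues T t)
    (hT : ∀ i, 6 ≤ 2 * blocks (T i).2 + ∑ j, cornerDeg (T i) j)
    (ht : 2 * blocks t.2 + ∑ i, cornerDeg t i ≤ 8) (i : Fin 3) :
    2 * blocks (T i).2 + ∑ j, cornerDeg (T i) j ≤ 8 := by
  obtain ⟨h1, h2, h3⟩ := h
  have hb := ((induces_and_blocks_iff (fun i => (T i).2) t.2).2 h3).2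
  simp only [Fin.sum_univ_three] at *
  have := h1 0
  have := h1 1
  have := h1 2
  have := h2 0 1 (by decide)
  have := h2 0 2 (by decide)
  have := h2 1 2 (by decide)
  have := hT 0
  have := hT 1
  have := hT 2
  fin_cases i <;> simp only [Fin.zero_eta, Fin.mk_one, Fin.reduceFinMk] <;> omega

/-- the edge sets contained in `X` with state `t` -/
def stateSets (W : Finset α) (c : Fin 3 → α) (X : Finset (Sym2 α)) (t : St) :
    Finset (Finset (Sym2 α)) := X.powerset.filter fun S => HasState W c S t

theorem mem_stateSets {X : Finset (Sym2 α)} :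
    S ∈ stateSets W c X t ↔ S ⊆ X ∧ HasState W c S t := by
  rw [stateSets, Finset.mem_filter, Finset.mem_powerset]

end Counting

namespace IsGluing

variable {α : Type*} [DecidableEq α] {W : Fin 3 → Finset α} {c : Fin 3 → Fin 3 → α}
  {X : Fin 3 → Finset (Sym2 α)} {t : St}

theorem stateSets_eq (hG : IsGluing W c) (hX : ∀ i, Supported (W i) (X i))
    (hB : ∀ i, ∀ S ⊆ X i, EdgeBound (W i) (c i) S) (ht : t ∈ states) :
    stateSets (Finset.univ.biUnion W) (fun i => c i i) (Finset.univ.biUnion X) t =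
      (glueList t).toFinset.biUnion fun T => (Fintype.piFinset fun i =>
        stateSets (W i) (c i) (X i) (![T.1, T.2.1, T.2.2] i)).image fun S =>
          Finset.univ.biUnion S := by
  ext S
  simp only [Finset.mem_biUnion, List.mem_toFinset, Finset.mem_image, Fintype.mem_piFinset,
    mem_stateSets]
  constructor
  · rintro ⟨hS, h⟩
    have hU : S = Finset.univ.biUnion fun i => S ∩ X i := by
      rw [← Finset.inter_biUnion, Finset.inter_eq_left.2 hS]
    have hSX : ∀ i, S ∩ X i ⊆ X i := fun i => Finset.inter_subset_right
    have hsup : ∀ i, Supported (W i) (S ∩ X i) := fun i => (hX i).mono (hSX i)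
    rw [hU, hG.hasState_iff hsup fun i => hB i _ (hSX i)] at h
    obtain ⟨T, hT, hg⟩ := h
    have hT3 : ![T 0, T 1, T 2] = T := by ext1 i; fin_cases i <;> rfl
    have hle : 2 * blocks t.2 + ∑ i, cornerDeg t i ≤ 8 := by
      have := mem_states.1 ht
      simp only [okState, Bool.and_eq_true, decide_eq_true_eq] at this
      rw [Fin.sum_univ_three]
      exact this.2
    have hTs : ∀ i, T i ∈ states := fun i => mem_states.2 <|
      (hT i).okState (hsup i) (hG.mem i) (hG.inj i) <|
        hg.le_sum (fun i => (hT i).le_sum (hsup i) (hG.mem i) (hG.inj i)) hle i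
    refine ⟨(T 0, T 1, T 2), mem_glueList.2 ⟨⟨hTs 0, hTs 1, hTs 2⟩, by rwa [hT3]⟩,
      fun i => S ∩ X i, ?_, hU.symm⟩
    rw [hT3]
    exact fun i => ⟨hSX i, hT i⟩
  · rintro ⟨T, hT, S', hS', rfl⟩
    refine ⟨Finset.biUnion_mono fun i _ => (hS' i).1, ?_⟩
    exact (hG.hasState_iff (fun i => (hX i).mono (hS' i).1) (fun i => hB i _ (hS' i).1) t).2
      ⟨_, fun i => (hS' i).2, (mem_glueList.1 hT).2⟩

theorem biUnion_inter (hG : IsGluing W c) (hX : ∀ i, Supported (W i) (X i))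
    {S : Fin 3 → Finset (Sym2 α)} (hS : ∀ i, S i ⊆ X i) (i : Fin 3) :
    Finset.univ.biUnion S ∩ X i = S i := by
  ext e
  simp only [Finset.mem_inter, Finset.mem_biUnion, Finset.mem_univ, true_and]
  refine ⟨?_, fun h => ⟨⟨i, h⟩, hS i h⟩⟩
  rintro ⟨⟨j, hj⟩, hi⟩
  by_cases hji : j = i
  · exact hji ▸ hj
  · exact absurd hi (Finset.disjoint_left.1 (hG.disjoint hX hji) (hS j hj))

theorem card_stateSets (hG : IsGluing W c) (hX : ∀ i, Supported (W i) (X i))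
    (hB : ∀ i, ∀ S ⊆ X i, EdgeBound (W i) (c i) S) (ht : t ∈ states) :
    (stateSets (Finset.univ.biUnion W) (fun i => c i i) (Finset.univ.biUnion X) t).card =
      ((glueList t).map fun T => (stateSets (W 0) (c 0) (X 0) T.1).card *
        ((stateSets (W 1) (c 1) (X 1) T.2.1).card *
          (stateSets (W 2) (c 2) (X 2) T.2.2).card)).sum := by
  rw [hG.stateSets_eq hX hB ht, Finset.card_biUnion, ← List.sum_toFinset _ (glueList_nodup t)]
  · refine Finset.sum_congr rfl fun T _ => ?_
    rw [Finset.card_image_of_injOn, Fintype.card_piFinset, Fin.prod_univ_three, mul_assoc]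
    · rfl
    · intro S hS S' hS' h
      simp only [Finset.mem_coe, Fintype.mem_piFinset, mem_stateSets] at hS hS'
      ext1 i
      rw [← hG.biUnion_inter hX (fun i => (hS i).1) i, ← hG.biUnion_inter hX (fun i => (hS' i).1) i]
      exact congrArg (· ∩ X i) h
  · intro T _ T' _ hne
    rw [Function.onFun, Finset.disjoint_left]
    simp only [Finset.mem_image, Fintype.mem_piFinset, mem_stateSets]
    rintro _ ⟨S, hS, rfl⟩ ⟨S', hS', h⟩
    have hSS : S' = S := by
      ext1 i
      rw [← hG.biUnion_inter hX (fun i => (hS i).1) i, ← hG.biUnion_inter hX (fun i => (hS' i).1) i]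
      exact congrArg (· ∩ X i) h
    subst hSS
    have hu := fun i => (hS i).2.unique (hS' i).2
    exact hne (Prod.ext (hu 0) (Prod.ext (hu 1) (hu 2)))

end IsGluing

/-! ### Transport along injections, and the triangle -/

section Transport

variable {α β : Type*} [DecidableEq α] [DecidableEq β] {φ : α → β} (hφ : Function.Injective φ)
include hφ

omit [DecidableEq α] in
theorem mk_mem_image_map {S : Finset (Sym2 α)} {x : α} {w : β} :
    s(φ x, w) ∈ S.image (Sym2.map φ) ↔ ∃ y, φ y = w ∧ s(x, y) ∈ S := by
  constructor
  · intro h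
    obtain ⟨e, he, hew⟩ := Finset.mem_image.1 h
    have hx : φ x ∈ Sym2.map φ e := hew ▸ Sym2.mem_mk_left _ _
    obtain ⟨x', hx', hxx⟩ := Sym2.mem_map.1 hx
    obtain rfl := hφ hxx
    obtain ⟨y, rfl⟩ := hx'
    rw [Sym2.map_mk] at hew
    exact ⟨y, Sym2.congr_right.1 hew, he⟩
  · rintro ⟨y, rfl, hy⟩
    exact Finset.mem_image.2 ⟨_, hy, Sym2.map_mk _ _ _⟩

omit [DecidableEq α] in
theorem conn_image_iff {S : Finset (Sym2 α)} {x y : α} :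
    Conn (S.image (Sym2.map φ)) (φ x) (φ y) ↔ Conn S x y := by
  constructor
  · have key : ∀ w, Conn (S.image (Sym2.map φ)) (φ x) w → ∃ z, φ z = w ∧ Conn S x z := by
      intro w h
      induction h with
      | refl => exact ⟨x, rfl, Relation.ReflTransGen.refl⟩
      | tail _ hyz ih =>
        obtain ⟨z, rfl, hz⟩ := ih
        obtain ⟨u, hu, hzu⟩ := (mk_mem_image_map hφ).1 hyz
        exact ⟨u, hu, hz.tail hzu⟩
    intro h
    obtain ⟨z, hz, hxz⟩ := key _ h
    exact hφ hz ▸ hxz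
  · exact fun h => h.lift φ fun u v huv => (mk_mem_image_map hφ).2 ⟨v, rfl, huv⟩

theorem deg_image (S : Finset (Sym2 α)) (x : α) :
    deg (S.image (Sym2.map φ)) (φ x) = deg S x := by
  have h : (S.image (Sym2.map φ)).filter (fun e => φ x ∈ e) =
      (S.filter fun e => x ∈ e).image (Sym2.map φ) := by
    rw [Finset.filter_image]
    congr 1
    refine Finset.filter_congr fun e _ => ?_
    rw [Sym2.mem_map]
    exact ⟨fun ⟨y, hy, hyx⟩ => hφ hyx ▸ hy, fun h => ⟨x, h, rfl⟩⟩
  rw [deg, h, Finset.card_image_of_injective _ (Sym2.map.injective hφ), deg]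

omit [DecidableEq α] in
theorem Supported.image {W : Finset α} {S : Finset (Sym2 α)} (hS : Supported W S) :
    Supported (W.image φ) (S.image (Sym2.map φ)) := by
  intro e he
  obtain ⟨e, he', rfl⟩ := Finset.mem_image.1 he
  obtain ⟨h1, h2⟩ := hS e he'
  refine ⟨by rwa [Sym2.isDiag_map hφ], fun v hv => ?_⟩
  obtain ⟨w, hw, rfl⟩ := Sym2.mem_map.1 hv
  exact Finset.mem_image_of_mem _ (h2 w hw)

variable {W : Finset α} {c : Fin 3 → α}

omit [DecidableEq α] in
theorem EdgeBound.image {S : Finset (Sym2 α)} (h : EdgeBound W c S) :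
    EdgeBound (W.image φ) (fun i => φ (c i)) (S.image (Sym2.map φ)) := by
  intro q h1 h2
  simp only [Finset.forall_mem_image, conn_image_iff hφ] at h1 h2
  rw [Finset.card_image_of_injective _ hφ,
    Finset.card_image_of_injective _ (Sym2.map.injective hφ)]
  exact h q h1 h2

theorem hasState_image_iff {S : Finset (Sym2 α)} {t : St} :
    HasState (W.image φ) (fun i => φ (c i)) (S.image (Sym2.map φ)) t ↔ HasState W c S t := by
  have hc := Finset.card_image_of_injective W hφ
  have hs := Finset.card_image_of_injective S (Sym2.map.injective hφ)
  constructor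
  · rintro ⟨h1, h2, h3, h4, h5⟩
    simp only [Finset.forall_mem_image, conn_image_iff hφ, deg_image hφ, hc, hs] at h1 h2 h3 h4 h5
    exact ⟨h1, h2, h3, h4, h5⟩
  · rintro ⟨h1, h2, h3, h4, h5⟩
    constructor <;>
      simpa only [Finset.forall_mem_image, conn_image_iff hφ, deg_image hφ, hc, hs]

theorem card_stateSets_image (X : Finset (Sym2 α)) (t : St) :
    (stateSets (W.image φ) (fun i => φ (c i)) (X.image (Sym2.map φ)) t).card =
      (stateSets W c X t).card := by
  have h : stateSets (W.image φ) (fun i => φ (c i)) (X.image (Sym2.map φ)) t =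
      (stateSets W c X t).image (Finset.image (Sym2.map φ)) := by
    ext S
    simp only [mem_stateSets, Finset.mem_image]
    constructor
    · rintro ⟨hS, h⟩
      obtain ⟨S, hS', rfl⟩ := Finset.subset_image_iff.1 hS
      exact ⟨S, ⟨hS', (hasState_image_iff hφ).1 h⟩, rfl⟩
    · rintro ⟨S, ⟨hS, h⟩, rfl⟩
      exact ⟨Finset.image_mono _ hS, (hasState_image_iff hφ).2 h⟩
  rw [h, Finset.card_image_of_injective]
  exact Finset.image_injective (Sym2.map.injective hφ)

end Transport

/-- the edges of the triangle -/
def triangle : Finset (Sym2 (Fin 3)) := {s(0, 1), s(0, 2), s(1, 2)}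

/-- connectivity in a graph with three vertices -/
def conn3 (S : Finset (Sym2 (Fin 3))) (x y : Fin 3) : Bool :=
  x == y || decide (s(x, y) ∈ S) ||
    (List.finRange 3).any fun z => decide (s(x, z) ∈ S) && decide (s(z, y) ∈ S)

theorem conn3_tail : ∀ S ∈ triangle.powerset, ∀ x y z, conn3 S x y = true → s(y, z) ∈ S →
    conn3 S x z = true := by
  decide +kernel

theorem conn_iff_conn3 {S : Finset (Sym2 (Fin 3))} (hS : S ∈ triangle.powerset) (x y : Fin 3) :
    Conn S x y ↔ conn3 S x y = true := by
  constructor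
  · intro h
    induction h with
    | refl => simp [conn3]
    | tail _ hyz ih => exact conn3_tail S hS _ _ _ ih hyz
  · intro h
    simp only [conn3, Bool.or_eq_true, beq_iff_eq, decide_eq_true_eq, List.any_eq_true,
      List.mem_finRange, true_and, Bool.and_eq_true] at h
    obtain (rfl | h) | ⟨z, h1, h2⟩ := h
    · exact Relation.ReflTransGen.refl
    · exact Relation.ReflTransGen.single h
    · exact (Relation.ReflTransGen.single h1).tail h2

theorem supported_triangle : Supported Finset.univ triangle := by
  intro e he
  refine ⟨?_, fun v _ => Finset.mem_univ v⟩
  revert e; decide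

theorem edgeBound_triangle {S : Finset (Sym2 (Fin 3))} (hS : S ⊆ triangle) :
    EdgeBound Finset.univ id S := by
  have key : ∀ S ∈ triangle.powerset, ∀ q, (∀ i j, conn3 S i j = cornerRel q i j) →
      3 ≤ S.card + blocks q := by decide +kernel
  intro q _ h
  refine key S (Finset.mem_powerset.2 hS) q fun i j => ?_
  rw [Bool.eq_iff_iff, ← h, ← conn_iff_conn3 (Finset.mem_powerset.2 hS)]
  rfl

theorem card_stateSets_triangle : ∀ t ∈ states, cls t ≠ 10 →
    (stateSets Finset.univ id triangle t).card = val 0 (cls t) := by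
  have key : ∀ t ∈ states, cls t ≠ 10 → (triangle.powerset.filter fun S =>
      (∀ v, deg S v ≤ 2) ∧ (∀ i, deg S i = cornerDeg t i) ∧
        (∀ i j, conn3 S i j = cornerRel t.2 i j) ∧ 3 = S.card + blocks t.2).card =
          val 0 (cls t) := by decide +kernel
  intro t ht h
  rw [← key t ht h, stateSets]
  congr 1
  refine Finset.filter_congr fun S hS => ?_
  constructor
  · rintro ⟨h1, h2, h3, h4, h5⟩
    refine ⟨fun v => h1 v (Finset.mem_univ v), h3, fun i j => ?_, h5⟩
    rw [Bool.eq_iff_iff, ← h4, ← conn_iff_conn3 hS]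
    rfl
  · rintro ⟨h1, h2, h3, h4⟩
    refine ⟨fun v _ => h1 v, fun v _ => ⟨v, Relation.ReflTransGen.refl⟩, h2, fun i j => ?_, h4⟩
    rw [← h3, ← conn_iff_conn3 hS]
    rfl

/-! ### The Sierpinski gasket graphs -/

/-- the corners of `SG n`, which are also the translation vectors used to build `SG (n + 1)` -/
def corner (n : ℕ) : Fin 3 → ℝ × ℝ := ![o, a n, b n]

/-- `V n` as a finite set -/
def vertices : ℕ → Finset (ℝ × ℝ)
  | 0 => Finset.univ.image (corner 0)
  | n + 1 => Finset.univ.biUnion fun i => (vertices n).image (· + corner n i)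

/-- `E n` as a finite set -/
def edges : ℕ → Finset (Sym2 (ℝ × ℝ))
  | 0 => triangle.image (Sym2.map (corner 0))
  | n + 1 => Finset.univ.biUnion fun i => (edges n).image (Sym2.map (· + corner n i))

theorem o_eq_zero : o = 0 := rfl

theorem coe_vertices (n : ℕ) : (vertices n : Set (ℝ × ℝ)) = V n := by
  induction n with
  | zero =>
    ext v
    simp only [vertices, V, Finset.coe_image, Finset.coe_univ, Set.image_univ, Set.mem_range,
      Fin.exists_fin_succ, Fin.exists_fin_zero, Set.mem_insert_iff, Set.mem_singleton_iff, or_false]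
    exact or_congr eq_comm (or_congr eq_comm eq_comm)
  | succ n ih =>
    ext v
    rw [V, ← ih]
    simp [vertices, corner, Fin.exists_fin_succ, o_eq_zero, or_assoc]

theorem coe_edges (n : ℕ) : (edges n : Set (Sym2 (ℝ × ℝ))) = E n := by
  induction n with
  | zero =>
    ext e
    simp [edges, E, corner, triangle]
  | succ n ih =>
    ext e
    have h : Sym2.map (fun x : ℝ × ℝ => x) = id := Sym2.map_id
    rw [E, ← ih]
    simp [edges, corner, Fin.exists_fin_succ, o_eq_zero, or_assoc, h]

theorem sq3_pos : 0 < sq3 := Real.sqrt_pos.2 (by norm_num)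

theorem corner_succ (n : ℕ) (i : Fin 3) : corner (n + 1) i = corner n i + corner n i := by
  fin_cases i <;> simp [corner, o, a, b, pow_succ] <;> ring_nf

theorem corner_injective (n : ℕ) : Function.Injective (corner n) := by
  have h2 : (0 : ℝ) < 2 ^ n := by positivity
  have h3 := sq3_pos
  intro i j
  fin_cases i <;> fin_cases j <;> simp [corner, o, a, b, h2.ne', h2.ne, h3.ne']

theorem corner_mem (n : ℕ) (i : Fin 3) : corner n i ∈ vertices n := by
  induction n with
  | zero => exact Finset.mem_image_of_mem _ (Finset.mem_univ i)
  | succ n ih =>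
    exact Finset.mem_biUnion.2 ⟨i, Finset.mem_univ i, Finset.mem_image.2 ⟨_, ih, (corner_succ n i).symm⟩⟩

theorem vertices_bounds (n : ℕ) : ∀ v ∈ vertices n, 0 ≤ v.2 ∧ v.2 ≤ sq3 * v.1 ∧
    sq3 * v.1 + v.2 ≤ sq3 * 2 ^ n := by
  have h3 := sq3_pos
  induction n with
  | zero =>
    intro v hv
    obtain ⟨i, -, rfl⟩ := Finset.mem_image.1 hv
    fin_cases i <;> simp [corner, o, a, b] <;> (try constructor) <;> (try constructor) <;> nlinarith
  | succ n ih =>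
    intro v hv
    obtain ⟨i, -, hv⟩ := Finset.mem_biUnion.1 hv
    obtain ⟨w, hw, rfl⟩ := Finset.mem_image.1 hv
    obtain ⟨h0, h1, h2⟩ := ih w hw
    have h4 : 0 < sq3 * 2 ^ n := by positivity
    rw [pow_succ]
    fin_cases i <;> simp [corner, o, a, b] <;> refine ⟨?_, ?_, ?_⟩ <;> linarith

theorem isGluing_vertices (n : ℕ) : IsGluing (fun i => (vertices n).image (· + corner n i))
    (fun i j => corner n j + corner n i) where
  symm i j := add_comm _ _
  mem i j := Finset.mem_image_of_mem _ (corner_mem n j)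
  inj i := (add_left_injective _).comp (corner_injective n)
  inter i j v hij hi hj := by
    have h3 := sq3_pos
    obtain ⟨w, hw, rfl⟩ := Finset.mem_image.1 hi
    obtain ⟨w', hw', h⟩ := Finset.mem_image.1 hj
    obtain ⟨h0, h1, h2⟩ := vertices_bounds n w hw
    obtain ⟨h0', h1', h2'⟩ := vertices_bounds n w' hw'
    obtain ⟨e1, e2⟩ := Prod.ext_iff.1 h
    have e1' := congrArg (sq3 * ·) e1
    suffices hs : sq3 * w.1 = sq3 * (corner n j).1 ∧ w.2 = (corner n j).2 by
      rw [Prod.ext (mul_left_cancel₀ h3.ne' hs.1) hs.2]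
    revert e1' e2
    fin_cases i <;> fin_cases j <;> first | exact absurd rfl hij | skip
    all_goals
      simp only [corner, o, a, b, Fin.zero_eta, Fin.mk_one, Fin.reduceFinMk, Matrix.cons_val,
        Prod.fst_add, Prod.snd_add]
      intro e2 e1'
      ring_nf at e1' e2 h2 h2' ⊢
      constructor <;> linarith

theorem supported_edges (n : ℕ) : Supported (vertices n) (edges n) := by
  induction n with
  | zero => exact supported_triangle.image (corner_injective 0)
  | succ n ih =>
    intro e he
    obtain ⟨i, -, he⟩ := Finset.mem_biUnion.1 he
    obtain ⟨h1, h2⟩ := ih.image (add_left_injective (corner n i)) e he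
    exact ⟨h1, fun v hv => Finset.mem_biUnion.2 ⟨i, Finset.mem_univ i, h2 v hv⟩⟩

theorem edgeBound_edges (n : ℕ) : ∀ S ⊆ edges n, EdgeBound (vertices n) (corner n) S := by
  induction n with
  | zero =>
    intro S hS
    obtain ⟨S, hS', rfl⟩ := Finset.subset_image_iff.1 hS
    exact (edgeBound_triangle hS').image (corner_injective 0)
  | succ n ih =>
    intro S hS
    have hU : S = Finset.univ.biUnion fun i => S ∩ (edges n).image (Sym2.map (· + corner n i)) := by
      rw [← Finset.inter_biUnion]
      exact (Finset.inter_eq_left.2 hS).symm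
    rw [hU, show corner (n + 1) = _ from funext (corner_succ n)]
    refine (isGluing_vertices n).edgeBound (fun i => ?_) fun i => ?_
    · exact ((supported_edges n).image (add_left_injective _)).mono Finset.inter_subset_right
    · obtain ⟨S', hS', h⟩ := Finset.subset_image_iff.1 (Finset.inter_subset_right (s₁ := S)
        (s₂ := (edges n).image (Sym2.map (· + corner n i))))
      rw [← h]
      exact (ih S' hS').image (add_left_injective _)

theorem sortTriple_val (n : ℕ) (x y z : Fin 11) :
    val n (sortTriple (x, y, z)).1 * (val n (sortTriple (x, y, z)).2.1 *
      val n (sortTriple (x, y, z)).2.2) = val n x * (val n y * val n z) := by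
  have key : (sortTriple (x, y, z) = (x, y, z) ∨ sortTriple (x, y, z) = (x, z, y)) ∨
      (sortTriple (x, y, z) = (y, x, z) ∨ sortTriple (x, y, z) = (y, z, x)) ∨
      (sortTriple (x, y, z) = (z, x, y) ∨ sortTriple (x, y, z) = (z, y, x)) := by
    revert x y z; decide +kernel
  obtain (h | h) | (h | h) | (h | h) := key <;> rw [h] <;> ring

theorem val_sum_flatMap_replicate (n : ℕ) (L : List (ℕ × Fin 11 × Fin 11 × Fin 11)) :
    ((L.flatMap fun m => List.replicate m.1 m.2).map fun x =>
      val n x.1 * (val n x.2.1 * val n x.2.2)).sum =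
    (L.map fun m => m.1 * (val n m.2.1 * (val n m.2.2.1 * val n m.2.2.2))).sum := by
  induction L with
  | nil => rfl
  | cons m L ih =>
    simp only [List.flatMap_cons, List.map_append, List.sum_append, ih, List.map_replicate,
      List.sum_replicate, smul_eq_mul, List.map_cons, List.sum_cons]

theorem poly_ne : ∀ k, ∀ m ∈ poly k, 0 < m.1 ∧ m.2.1 ≠ 10 ∧ m.2.2.1 ≠ 10 ∧ m.2.2.2 ≠ 10 := by
  decide +kernel

theorem sortTriple_ne : ∀ x y z : Fin 11, (sortTriple (x, y, z)).1 ≠ 10 →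
    (sortTriple (x, y, z)).2.1 ≠ 10 → (sortTriple (x, y, z)).2.2 ≠ 10 →
      x ≠ 10 ∧ y ≠ 10 ∧ z ≠ 10 := by
  decide +kernel

theorem card_stateSets_edges (n : ℕ) : ∀ t ∈ states, cls t ≠ 10 →
    (stateSets (vertices n) (corner n) (edges n) t).card = val n (cls t) := by
  induction n with
  | zero =>
    intro t ht h
    rw [← card_stateSets_triangle t ht h]
    exact card_stateSets_image (corner_injective 0) triangle t
  | succ n ih =>
    intro t ht h
    have hB : ∀ i, ∀ S ⊆ (edges n).image (Sym2.map (· + corner n i)),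
        EdgeBound ((vertices n).image (· + corner n i)) (fun j => corner n j + corner n i) S := by
      intro i S hS
      obtain ⟨S, hS', rfl⟩ := Finset.subset_image_iff.1 hS
      exact (edgeBound_edges n S hS').image (add_left_injective _)
    have hi : ∀ i t, (stateSets ((vertices n).image (· + corner n i))
        (fun j => corner n j + corner n i) ((edges n).image (Sym2.map (· + corner n i))) t).card =
          (stateSets (vertices n) (corner n) (edges n) t).card := fun i t =>
      card_stateSets_image (add_left_injective (corner n i)) (edges n) t
    have hr := (isGluing_vertices n).card_stateSets
      (fun i => (supported_edges n).image (add_left_injective (corner n i))) hB ht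
    simp only [← corner_succ] at hr
    rw [vertices, edges, show corner (n + 1) = fun i => corner (n + 1) i from rfl, hr]
    simp only [hi]
    have hp := List.isPerm_iff.1 (glueList_perm t ht h)
    have hne : ∀ T ∈ glueList t, cls T.1 ≠ 10 ∧ cls T.2.1 ≠ 10 ∧ cls T.2.2 ≠ 10 := by
      intro T hT
      have h1 := hp.subset (List.mem_map_of_mem hT)
      obtain ⟨m, hm, h2⟩ := List.mem_flatMap.1 h1
      have h3 := poly_ne _ m hm
      rw [← List.eq_of_mem_replicate h2] at h3
      exact sortTriple_ne _ _ _ h3.2.1 h3.2.2.1 h3.2.2.2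
    have he : ∀ T ∈ glueList t, (stateSets (vertices n) (corner n) (edges n) T.1).card *
        ((stateSets (vertices n) (corner n) (edges n) T.2.1).card *
          (stateSets (vertices n) (corner n) (edges n) T.2.2).card) =
        (fun x => val n x.1 * (val n x.2.1 * val n x.2.2))
          (sortTriple (cls T.1, cls T.2.1, cls T.2.2)) := by
      intro T hT
      obtain ⟨⟨h1, h2, h3⟩, -⟩ := mem_glueList.1 hT
      obtain ⟨h1', h2', h3'⟩ := hne T hT
      rw [ih _ h1 h1', ih _ h2 h2', ih _ h3 h3']
      exact (sortTriple_val n _ _ _).symm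
    rw [List.map_congr_left he]
    have hs := (hp.map fun x => val n x.1 * (val n x.2.1 * val n x.2.2)).sum_eq
    rw [val_sum_flatMap_replicate, List.map_map] at hs
    exact hs.trans (by simp only [val, mul_assoc])

/-! ### Hamiltonian paths and edge sets -/

section HamPaths

variable {α : Type*} [DecidableEq α]

/-- `S` is the edge set of a path with at least two vertices, the set of all vertices being `W` -/
structure IsPathSet (W : Finset α) (S : Finset (Sym2 α)) : Prop where
  deg_le : ∀ v ∈ W, deg S v ≤ 2
  conn : ∀ u ∈ W, ∀ v ∈ W, Conn S u v
  card_eq : W.card = S.card + 1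

theorem deg_insert {S : Finset (Sym2 α)} {e : Sym2 α} (he : e ∉ S) (x : α) :
    deg (insert e S) x = deg S x + if x ∈ e then 1 else 0 := by
  rw [deg, Finset.filter_insert]
  split_ifs with h
  · rw [Finset.card_insert_of_notMem fun h' => he (Finset.mem_filter.1 h').1, deg]
  · rw [deg, add_zero]

section Walk

variable {Γ : SimpleGraph α} {u v : α}

theorem deg_edges {p : Γ.Walk u v} (hp : p.IsPath) (x : α) :
    deg p.edges.toFinset x + (if x = u then 1 else 0) + (if x = v then 1 else 0) =
      if x ∈ p.support then 2 else 0 := by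
  induction p with
  | nil =>
    simp only [SimpleGraph.Walk.edges_nil, List.toFinset_nil, SimpleGraph.Walk.support_nil,
      List.mem_singleton, deg, Finset.filter_empty, Finset.card_empty]
    split_ifs <;> rfl
  | @cons u w v h p ih =>
    rw [SimpleGraph.Walk.cons_isPath_iff] at hp
    obtain ⟨hp, hu⟩ := hp
    have hne : s(u, w) ∉ p.edges.toFinset := fun hm =>
      hu (p.fst_mem_support_of_mem_edges (List.mem_toFinset.1 hm))
    have huw : u ≠ w := h.ne
    have huv : u ≠ v := fun huv => hu (huv ▸ p.end_mem_support)
    have hw := p.start_mem_support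
    specialize ih hp
    rw [SimpleGraph.Walk.edges_cons, List.toFinset_cons, deg_insert hne,
      SimpleGraph.Walk.support_cons]
    simp only [List.mem_cons, Sym2.mem_iff]
    by_cases hxu : x = u
    · subst hxu
      simp only [if_neg hu, huw, huv, if_false] at ih
      simpa [huv] using ih
    · by_cases hxw : x = w
      · subst hxw
        simp only [if_true, hw] at ih
        simp only [hxu, hw, or_true, if_true, if_false]
        omega
      · simpa [hxu, hxw] using ih

theorem conn_edges (p : Γ.Walk u v) : ∀ x ∈ p.support, Conn p.edges.toFinset u x := by
  induction p with
  | nil =>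
    intro x hx
    rw [SimpleGraph.Walk.support_nil, List.mem_singleton] at hx
    exact hx ▸ Relation.ReflTransGen.refl
  | @cons u w v h p ih =>
    intro x hx
    rw [SimpleGraph.Walk.edges_cons, List.toFinset_cons]
    obtain rfl | hx := List.mem_cons.1 (SimpleGraph.Walk.support_cons h p ▸ hx)
    · exact Relation.ReflTransGen.refl
    · exact Relation.ReflTransGen.head (Finset.mem_insert_self _ _)
        ((ih x hx).mono (Finset.subset_insert _ _))

theorem card_edges {p : Γ.Walk u v} (hp : p.IsPath) :
    p.edges.toFinset.card + 1 = p.support.toFinset.card := by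
  rw [List.toFinset_card_of_nodup hp.isTrail.edges_nodup,
    List.toFinset_card_of_nodup hp.support_nodup, SimpleGraph.Walk.length_edges,
    SimpleGraph.Walk.length_support]

theorem eq_of_edges_eq {p q : Γ.Walk u v} (hp : p.IsPath) (hq : q.IsPath)
    (h : p.edges.toFinset = q.edges.toFinset) : p = q := by
  induction p with
  | nil => exact (SimpleGraph.Walk.eq_nil_iff_nil.2 (SimpleGraph.Walk.isPath_iff_nil.1 hq)).symm
  | @cons u w v hu p ih =>
    rw [SimpleGraph.Walk.cons_isPath_iff] at hp
    cases q with
    | nil => exact absurd p.end_mem_support hp.2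
    | @cons _ w' _ hu' q =>
      rw [SimpleGraph.Walk.cons_isPath_iff] at hq
      rw [SimpleGraph.Walk.edges_cons, SimpleGraph.Walk.edges_cons, List.toFinset_cons,
        List.toFinset_cons] at h
      have hnp : ∀ z, s(u, z) ∉ p.edges.toFinset := fun z hm =>
        hp.2 (p.fst_mem_support_of_mem_edges (List.mem_toFinset.1 hm))
      have hnq : ∀ z, s(u, z) ∉ q.edges.toFinset := fun z hm =>
        hq.2 (q.fst_mem_support_of_mem_edges (List.mem_toFinset.1 hm))
      have hm : s(u, w) ∈ insert s(u, w') q.edges.toFinset := h ▸ Finset.mem_insert_self _ _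
      obtain rfl : w = w' := Sym2.congr_right.1
        ((Finset.mem_insert.1 hm).resolve_right (hnq w))
      have he : p.edges.toFinset = q.edges.toFinset := by
        rw [← Finset.erase_insert (hnp w), h, Finset.erase_insert (hnq w)]
      rw [ih hp.1 hq.1 he]

end Walk

variable {W : Finset α} {X : Finset (Sym2 α)}

theorem IsPathSet.deg_pos {S : Finset (Sym2 α)} (h : IsPathSet W S) (hW : 1 < W.card) {v : α}
    (hv : v ∈ W) : 0 < deg S v := by
  obtain ⟨u, hu, huv⟩ := Finset.exists_mem_ne hW v
  exact (h.conn v hv u hu).deg_pos huv.symm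

theorem IsPathSet.card_ends {S : Finset (Sym2 α)} (h : IsPathSet W S) (hS : Supported W S)
    (hW : 1 < W.card) : (W.filter fun v => deg S v = 1).card = 2 := by
  have h1 : ∑ v ∈ W, (deg S v + if deg S v = 1 then 1 else 0) = 2 * W.card := by
    rw [Finset.sum_const_nat (m := 2), mul_comm]
    intro v hv
    have := h.deg_le v hv
    have := h.deg_pos hW hv
    split_ifs <;> omega
  rw [Finset.sum_add_distrib, hS.sum_deg, ← Finset.card_filter] at h1
  have := h.card_eq
  omega

theorem isPathSet_edges {Γ : SimpleGraph α} {u v : α} {p : Γ.Walk u v} (hp : p.IsPath)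
    (hW : ∀ x, x ∈ p.support ↔ x ∈ W) : IsPathSet W p.edges.toFinset where
  deg_le x hx := by
    have := deg_edges hp x
    rw [if_pos ((hW x).2 hx)] at this
    omega
  conn x hx y hy := (conn_equivalence _).trans
    ((conn_equivalence _).symm (conn_edges p x ((hW x).2 hx))) (conn_edges p y ((hW y).2 hy))
  card_eq := by
    rw [card_edges hp]
    congr 1
    ext x
    rw [List.mem_toFinset, hW]

theorem IsPathSet.exists_walk {Γ : SimpleGraph α} {S : Finset (Sym2 α)} (h : IsPathSet W S)
    (hS : Supported W S) (hΓ : SimpleGraph.fromEdgeSet (S : Set (Sym2 α)) ≤ Γ) {u v : α}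
    (hu : u ∈ W) (hv : v ∈ W) (hdu : deg S u = 1) (hdv : deg S v = 1) (huv : u ≠ v) :
    ∃ p : Γ.Walk u v, p.IsPath ∧ (∀ x, x ∈ p.support ↔ x ∈ W) ∧ p.edges.toFinset = S := by
  have hr : (SimpleGraph.fromEdgeSet (S : Set (Sym2 α))).Reachable u v := by
    rw [SimpleGraph.reachable_iff_reflTransGen]
    refine Relation.ReflTransGen.mono (fun x y hxy => ?_) _ _ (h.conn u hu v hv)
    rw [SimpleGraph.fromEdgeSet_adj]
    refine ⟨hxy, fun he => (hS _ hxy).1 ?_⟩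
    rwa [Sym2.mk_isDiag_iff]
  obtain ⟨p, hp⟩ := hr.exists_isPath
  have hpS : p.edges.toFinset ⊆ S := fun e he => by
    have := p.edges_subset_edgeSet (List.mem_toFinset.1 he)
    rw [SimpleGraph.edgeSet_fromEdgeSet] at this
    exact this.1
  have hsub : ∀ x ∈ p.support, x ∈ W := fun x hx =>
    hS.mem_of_conn ((conn_edges p x hx).mono hpS) hu
  have hdeg : ∀ x ∈ p.support, deg S x ≤ deg p.edges.toFinset x := by
    intro x hx
    have h1 := deg_edges hp x
    have h2 := h.deg_le x (hsub x hx)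
    rw [if_pos hx] at h1
    by_cases hxu : x = u
    · subst hxu
      rw [if_pos rfl, if_neg huv] at h1
      omega
    · by_cases hxv : x = v
      · subst hxv
        rw [if_pos rfl, if_neg hxu] at h1
        omega
      · rw [if_neg hxv, if_neg hxu] at h1
        omega
  have hclosed : ∀ x ∈ p.support, ∀ e ∈ S, x ∈ e → e ∈ p.edges.toFinset := by
    intro x hx e he hxe
    have := Finset.eq_of_subset_of_card_le (Finset.filter_subset_filter (x ∈ ·) hpS) (hdeg x hx)
    exact (Finset.mem_filter.1 (this ▸ Finset.mem_filter.2 ⟨he, hxe⟩)).1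
  have hsup : ∀ x, x ∈ p.support ↔ x ∈ W := by
    refine fun x => ⟨hsub x, fun hx => ?_⟩
    have hc := h.conn u hu x hx
    clear hx
    induction hc with
    | refl => exact p.start_mem_support
    | @tail y z _ hyz ih =>
      exact p.snd_mem_support_of_mem_edges
        (List.mem_toFinset.1 (hclosed y ih _ hyz (Sym2.mem_mk_left _ _)))
  have hE : p.edges.toFinset = S := by
    refine Finset.eq_of_subset_of_card_le hpS ?_
    have h1 := (isPathSet_edges hp hsup).card_eq
    have h2 := h.card_eq
    omega
  refine ⟨p.mapLe hΓ, hp.mapLe hΓ, fun x => ?_, ?_⟩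
  · rw [SimpleGraph.Walk.support_mapLe_eq_support, hsup]
  · rw [SimpleGraph.Walk.edges_mapLe_eq_edges, hE]

/-- the edge sets contained in `X` of paths visiting all vertices -/
def pathSets (W : Finset α) (X : Finset (Sym2 α)) : Finset (Finset (Sym2 α)) :=
  X.powerset.filter (IsPathSet W)

theorem mem_pathSets {S : Finset (Sym2 α)} : S ∈ pathSets W X ↔ S ⊆ X ∧ IsPathSet W S := by
  rw [pathSets, Finset.mem_filter, Finset.mem_powerset]

theorem card_hamPaths (hX : Supported W X) (hW : 1 < W.card) (u v : α) :
    Nat.card {p : (SimpleGraph.fromEdgeSet (X : Set (Sym2 α))).Walk u v //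
      p.IsPath ∧ ∀ x, x ∈ p.support ↔ x ∈ W} =
    ((pathSets W X).filter fun S =>
      (u, v) ∈ (W.filter fun x => deg S x = 1).offDiag).card := by
  rw [← Nat.card_eq_finsetCard]
  have key : ∀ p : {p : (SimpleGraph.fromEdgeSet (X : Set (Sym2 α))).Walk u v //
      p.IsPath ∧ ∀ x, x ∈ p.support ↔ x ∈ W}, p.1.edges.toFinset ∈
      (pathSets W X).filter fun S => (u, v) ∈ (W.filter fun x => deg S x = 1).offDiag := by
    rintro ⟨p, hp, hpW⟩
    have huv : u ≠ v := by
      rintro rfl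
      obtain rfl := SimpleGraph.Walk.eq_nil_iff_nil.2 (SimpleGraph.Walk.isPath_iff_nil.1 hp)
      obtain ⟨x, hx, hxu⟩ := Finset.exists_mem_ne hW u
      exact hxu (by simpa using (hpW x).2 hx)
    have hu := deg_edges hp u
    have hv := deg_edges hp v
    rw [if_pos rfl, if_neg huv, if_pos p.start_mem_support] at hu
    rw [if_pos rfl, if_neg huv.symm, if_pos p.end_mem_support] at hv
    simp only [Finset.mem_filter, mem_pathSets, Finset.mem_offDiag]
    refine ⟨⟨fun e he => ?_, isPathSet_edges hp hpW⟩,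
      ⟨(hpW u).1 p.start_mem_support, by omega⟩, ⟨(hpW v).1 p.end_mem_support, by omega⟩, huv⟩
    have := p.edges_subset_edgeSet (List.mem_toFinset.1 he)
    rw [SimpleGraph.edgeSet_fromEdgeSet] at this
    exact this.1
  refine Nat.card_eq_of_bijective (fun p => ⟨_, key p⟩) ⟨fun p q h => ?_, fun S => ?_⟩
  · exact Subtype.ext (eq_of_edges_eq p.2.1 q.2.1 (Subtype.ext_iff.1 h))
  · obtain ⟨S, hS⟩ := S
    simp only [Finset.mem_filter, mem_pathSets, Finset.mem_offDiag] at hS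
    obtain ⟨⟨hSX, hP⟩, ⟨hu, hdu⟩, ⟨hv, hdv⟩, huv⟩ := hS
    obtain ⟨p, hp, hpW, rfl⟩ := hP.exists_walk (hX.mono hSX)
      (SimpleGraph.fromEdgeSet_mono (Finset.coe_subset.2 hSX)) hu hv hdu hdv huv
    exact ⟨⟨p, hp, hpW⟩, rfl⟩

theorem sum_card_hamPaths (hX : Supported W X) (hW : 1 < W.card) :
    ∑ᶠ u, ∑ᶠ v, Nat.card {p : (SimpleGraph.fromEdgeSet (X : Set (Sym2 α))).Walk u v //
      p.IsPath ∧ ∀ x, x ∈ p.support ↔ x ∈ W} = (pathSets W X).card * 2 := by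
  have h0 : ∀ u v, (u ∉ W ∨ v ∉ W) → Nat.card {p : (SimpleGraph.fromEdgeSet
      (X : Set (Sym2 α))).Walk u v // p.IsPath ∧ ∀ x, x ∈ p.support ↔ x ∈ W} = 0 := by
    intro u v huv
    rw [card_hamPaths hX hW, Finset.card_eq_zero, Finset.filter_eq_empty_iff]
    intro S _ h
    rw [Finset.mem_offDiag, Finset.mem_filter, Finset.mem_filter] at h
    exact huv.elim (· h.1.1) (· h.2.1.1)
  have h1 : ∀ u, ∑ᶠ v, Nat.card {p : (SimpleGraph.fromEdgeSet (X : Set (Sym2 α))).Walk u v //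
      p.IsPath ∧ ∀ x, x ∈ p.support ↔ x ∈ W} = ∑ v ∈ W, ((pathSets W X).filter fun S =>
      (u, v) ∈ (W.filter fun x => deg S x = 1).offDiag).card := by
    intro u
    rw [finsum_eq_sum_of_support_subset (s := W)]
    · exact Finset.sum_congr rfl fun v _ => card_hamPaths hX hW u v
    · exact fun v hv => by_contra fun hvW => hv (h0 u v (Or.inr hvW))
  rw [finsum_eq_sum_of_support_subset (s := W)]
  · simp only [h1]
    rw [← Finset.sum_product' (f := fun u v => ((pathSets W X).filter fun S =>
      (u, v) ∈ (W.filter fun x => deg S x = 1).offDiag).card)]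
    have h2 := Finset.sum_card_bipartiteAbove_eq_sum_card_bipartiteBelow (s := W ×ˢ W)
      (t := pathSets W X) (fun x S => x ∈ (W.filter fun x => deg S x = 1).offDiag)
    simp only [Finset.bipartiteAbove, Finset.bipartiteBelow] at h2
    rw [h2, Finset.sum_const_nat]
    intro S hS
    obtain ⟨hS, hP⟩ := mem_pathSets.1 hS
    have h3 : ((W ×ˢ W).filter fun x => x ∈ (W.filter fun x => deg S x = 1).offDiag) =
        (W.filter fun x => deg S x = 1).offDiag := by
      rw [Finset.filter_mem_eq_inter, Finset.inter_eq_right]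
      intro x hx
      rw [Finset.mem_offDiag, Finset.mem_filter, Finset.mem_filter] at hx
      exact Finset.mem_product.2 ⟨hx.1.1, hx.2.1.1⟩
    rw [h3, Finset.offDiag_card, hP.card_ends (hX.mono hS) hW]
  · refine fun u hu => by_contra fun huW => hu ?_
    exact finsum_eq_zero_of_forall_eq_zero fun v => h0 u v (Or.inl huW)

variable {c : Fin 3 → α}

theorem isPathSet_iff {S : Finset (Sym2 α)} (hS : Supported W S) (hc : ∀ i, c i ∈ W)
    (hi : Function.Injective c) :
    IsPathSet W S ↔ ∃ t ∈ states.filter fun t => t.2 == 0, HasState W c S t := by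
  have hr : ∀ i j, cornerRel 0 i j = true := by decide
  constructor
  · intro h
    have hd : ∀ j, cornerDeg ((deg S (c 0), deg S (c 1), deg S (c 2)), 0) j = deg S (c j) := by
      intro j
      fin_cases j <;> rfl
    have hst : HasState W c S ((deg S (c 0), deg S (c 1), deg S (c 2)), 0) :=
      ⟨h.deg_le, fun v hv => ⟨0, h.conn _ (hc 0) v hv⟩, fun i => (hd i).symm,
        fun i j => ⟨fun _ => hr i j, fun _ => h.conn _ (hc i) _ (hc j)⟩, h.card_eq⟩
    refine ⟨_, List.mem_filter.2 ⟨mem_states.2 (hst.okState hS hc hi ?_), rfl⟩, hst⟩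
    have h0 := h.deg_le _ (hc 0)
    have h1 := h.deg_le _ (hc 1)
    have h2 := h.deg_le _ (hc 2)
    simp only [Fin.sum_univ_three, hd, blocks, Fin.val_zero, if_true]
    omega
  · rintro ⟨t, ht, h⟩
    have h0 : t.2 = 0 := by simpa using (List.mem_filter.1 ht).2
    refine ⟨h.deg_le, fun u hu v hv => ?_, ?_⟩
    · obtain ⟨i, hiu⟩ := h.exists_conn u hu
      obtain ⟨j, hjv⟩ := h.exists_conn v hv
      have hij : Conn S (c i) (c j) := by
        rw [h.conn_iff, h0]
        exact hr i j
      exact (conn_equivalence S).trans ((conn_equivalence S).symm hiu) (hij.trans hjv)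
    · rw [h.card_eq, h0]
      rfl

theorem card_pathSets (hX : Supported W X) (hc : ∀ i, c i ∈ W) (hi : Function.Injective c) :
    (pathSets W X).card =
      ((states.filter fun t => t.2 == 0).map fun t => (stateSets W c X t).card).sum := by
  have h : pathSets W X =
      (states.filter fun t => t.2 == 0).toFinset.biUnion (stateSets W c X) := by
    ext S
    simp only [mem_pathSets, Finset.mem_biUnion, List.mem_toFinset, mem_stateSets]
    constructor
    · rintro ⟨hS, h⟩
      obtain ⟨t, ht, h⟩ := (isPathSet_iff (hX.mono hS) hc hi).1 h
      exact ⟨t, ht, hS, h⟩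
    · rintro ⟨t, ht, hS, h⟩
      exact ⟨hS, (isPathSet_iff (hX.mono hS) hc hi).2 ⟨t, ht, h⟩⟩
  rw [h, Finset.card_biUnion, ← List.sum_toFinset _ (states_nodup.filter _)]
  intro t _ t' _ hne
  rw [Function.onFun, Finset.disjoint_left]
  intro S hS hS'
  exact hne ((mem_stateSets.1 hS).2.unique (mem_stateSets.1 hS').2)

end HamPaths

theorem H_eq (n : ℕ) : H n = 3 * val n 1 + 3 * val n 3 + val n 9 := by
  have hW : 1 < (vertices n).card :=
    Finset.one_lt_card.2 ⟨_, corner_mem n 0, _, corner_mem n 1, fun h =>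
      absurd (corner_injective n h) (by decide)⟩
  have hs := sum_card_hamPaths (supported_edges n) hW
  have hf : ∀ u v, f n u v = Nat.card {p : (SimpleGraph.fromEdgeSet
      (edges n : Set (Sym2 (ℝ × ℝ)))).Walk u v //
        p.IsPath ∧ ∀ x, x ∈ p.support ↔ x ∈ vertices n} := by
    intro u v
    simp only [← Finset.mem_coe, coe_vertices]
    rw [coe_edges]
    rfl
  simp only [← hf] at hs
  rw [H, hs, Nat.mul_div_cancel _ two_pos,
    card_pathSets (supported_edges n) (corner_mem n) (corner_injective n)]
  have hl : (states.filter fun t => t.2 == 0).map cls = [1, 1, 3, 1, 3, 3, 9] := by decide +kernel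
  have hne : ∀ t ∈ states.filter fun t => t.2 == 0, cls t ≠ 10 := by decide +kernel
  have he : ∀ t ∈ states.filter fun t => t.2 == 0,
      (stateSets (vertices n) (corner n) (edges n) t).card = val n (cls t) := fun t ht =>
    card_stateSets_edges n t (List.mem_filter.1 ht).1 (hne t ht)
  rw [List.map_congr_left he, ← Function.comp_def (val n) cls, ← List.map_map, hl]
  simp only [List.map_cons, List.map_nil, List.sum_cons, List.sum_nil]
  ring

/-! ### Asymptotics of the number of Hamiltonian paths -/

theorem val_zero_zero (n : ℕ) : val (n + 1) 0 = 0 := by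
  simp [val, poly]

theorem two_mul_val_two (n : ℕ) : 2 * val (n + 1) 2 = 3 * val (n + 1) 1 := by
  induction n with
  | zero => decide +kernel
  | succ n ih =>
    rw [val, val]
    simp only [poly, List.map_cons, List.map_nil, List.sum_cons, List.sum_nil, val_zero_zero]
    linear_combination 2 * val (n + 1) 1 * val (n + 1) 2 * ih

theorem val_one_pos (n : ℕ) : 0 < val n 1 := by
  have h : ∀ n, 0 < val (n + 1) 1 := by
    intro n
    induction n with
    | zero => decide +kernel
    | succ n ih =>
      have := two_mul_val_two n
      rw [val]
      simp only [poly, List.map_cons, List.map_nil, List.sum_cons, List.sum_nil]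
      have : 0 < val (n + 1) 2 := by omega
      positivity
  cases n with
  | zero => decide
  | succ n => exact h n

theorem val_two_eq (n : ℕ) : (val (n + 1) 2 : ℝ) = 3 / 2 * val (n + 1) 1 := by
  have := two_mul_val_two n
  have : (2 * val (n + 1) 2 : ℝ) = 3 * val (n + 1) 1 := by exact_mod_cast this
  linarith

theorem val_one_succ (n : ℕ) : (val (n + 2) 1 : ℝ) = 3 * (val (n + 1) 1 : ℝ) ^ 3 := by
  rw [val]
  simp only [poly, List.map_cons, List.map_nil, List.sum_cons, List.sum_nil]
  push_cast
  rw [val_two_eq]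
  ring

theorem val_one_eq (n : ℕ) :
    (val (n + 1) 1 : ℝ) = Real.exp (Real.log 12 * 3 ^ n / 2) / √3 := by
  induction n with
  | zero =>
    have h : Real.exp (Real.log 12 * 3 ^ 0 / 2) = 2 * √3 := by
      rw [pow_zero, mul_one, show (12 : ℝ) = (2 * √3) ^ 2 by
        rw [mul_pow, Real.sq_sqrt (by norm_num)]; norm_num, Real.log_pow, Nat.cast_ofNat,
        mul_div_cancel_left₀ _ two_ne_zero, Real.exp_log (by positivity)]
    rw [h, mul_div_cancel_right₀ _ (by positivity), show val (0 + 1) 1 = 2 by decide +kernel]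
    norm_num
  | succ n ih =>
    rw [val_one_succ, ih, div_pow, ← Real.exp_nat_mul, pow_succ √3 2,
      Real.sq_sqrt (by norm_num), show ((3 : ℕ) : ℝ) * (Real.log 12 * 3 ^ n / 2) =
        Real.log 12 * 3 ^ (n + 1) / 2 by push_cast; ring]
    field_simp

theorem val_ratios (n : ℕ) :
    (val (n + 2) 3 : ℝ) = (119 / 27 * 4 ^ n - 2 / 27) * val (n + 2) 1 ∧
    (val (n + 2) 4 : ℝ) = (119 / 18 * 4 ^ n - 7 / 36) * val (n + 2) 1 ∧
    (val (n + 2) 5 : ℝ) = (119 / 12 * 4 ^ n - 5 / 12) * val (n + 2) 1 ∧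
    (val (n + 2) 6 : ℝ) = (119 / 9 * 4 ^ n - 47 / 36) * val (n + 2) 1 ∧
    (val (n + 2) 7 : ℝ) = (28322 / 1053 * (4 ^ n) ^ 2 - 2023 / 324 * 4 ^ n - 103 / 1296 +
      2827 / 1872 * 3 ^ n) * val (n + 2) 1 ∧
    (val (n + 2) 8 : ℝ) = (28322 / 351 * (4 ^ n) ^ 2 - 2261 / 108 * 4 ^ n + 223 / 144 +
      2827 / 624 * 3 ^ n) * val (n + 2) 1 := by
  induction n with
  | zero =>
    have h1 : val 2 1 = 24 := by decide +kernel
    have h3 : val 2 3 = 104 := by decide +kernel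
    have h4 : val 2 4 = 154 := by decide +kernel
    have h5 : val 2 5 = 228 := by decide +kernel
    have h6 : val 2 6 = 286 := by decide +kernel
    have h7 : val 2 7 = 530 := by decide +kernel
    have h8 : val 2 8 = 1580 := by decide +kernel
    norm_num [h1, h3, h4, h5, h6, h7, h8]
  | succ n ih =>
    obtain ⟨h3, h4, h5, h6, h7, h8⟩ := ih
    have h2 := val_two_eq (n + 1)
    have h0 := val_zero_zero (n + 1)
    rw [val_one_succ]
    refine ⟨?_, ?_, ?_, ?_, ?_, ?_⟩ <;>
    · rw [val]
      simp only [poly, List.map_cons, List.map_nil, List.sum_cons, List.sum_nil, h0]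
      push_cast
      simp only [h2, h3, h4, h5, h6, h7, h8]
      ring

theorem H_ratio (n : ℕ) :
    (H (n + 3) : ℝ) = (354025 / 3159 * (4 ^ n) ^ 2 + 12376 / 243 * 4 ^ n + 4391 / 1944 +
      2827 / 936 * 3 ^ n) * val (n + 3) 1 := by
  obtain ⟨h3, h4, h5, h6, h7, h8⟩ := val_ratios n
  have h9 : (val (n + 3) 9 : ℝ) = 6 * val (n + 2) 1 ^ 2 * val (n + 2) 4 +
      6 * val (n + 2) 1 ^ 2 * val (n + 2) 7 +
      6 * val (n + 2) 1 * val (n + 2) 3 * val (n + 2) 4 := by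
    rw [val]
    simp only [poly, List.map_cons, List.map_nil, List.sum_cons, List.sum_nil]
    push_cast
    ring
  rw [H_eq]
  push_cast
  rw [(val_ratios (n + 1)).1, val_one_succ (n + 1), h9, h3, h4, h7]
  ring

theorem tendsto_H_ratio :
    ∃ L : ℝ, 0 < L ∧ Tendsto (fun n => (H n : ℝ) / (val n 1 * 16 ^ n)) atTop (𝓝 L) := by
  refine ⟨354025 / 3159 / 16 ^ 3, by norm_num, ?_⟩
  rw [← tendsto_add_atTop_iff_nat 3]
  have h4 := tendsto_pow_atTop_nhds_zero_of_lt_one (r := (1 / 4 : ℝ)) (by norm_num) (by norm_num)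
  have h1 := tendsto_pow_atTop_nhds_zero_of_lt_one (r := (1 / 16 : ℝ)) (by norm_num) (by norm_num)
  have h3 := tendsto_pow_atTop_nhds_zero_of_lt_one (r := (3 / 16 : ℝ)) (by norm_num) (by norm_num)
  have := ((((h4.const_mul (12376 / 243)).const_add (354025 / 3159)).add
    (h1.const_mul (4391 / 1944))).add (h3.const_mul (2827 / 936))).div_const (16 ^ 3)
  simp only [mul_zero, add_zero] at this
  refine this.congr fun n => ?_
  have hv : (val (n + 3) 1 : ℝ) ≠ 0 := Nat.cast_ne_zero.2 (val_one_pos _).ne'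
  rw [H_ratio, mul_comm (val (n + 3) 1 : ℝ), mul_div_mul_right _ _ hv, pow_add, ← div_div]
  congr 1
  have h16 : (16 : ℝ) ^ n = (4 ^ n) ^ 2 := by rw [← pow_mul, mul_comm, pow_mul]; norm_num
  rw [div_pow, div_pow, div_pow, h16]
  field_simp
  ring

theorem Z_eq {A : ℕ → ℝ} (hA : ∀ n, 0 < A n) (n : ℕ) :
    Z (n + 1) (Real.log 12 / 9 + Real.log (A (n + 1)) / 3 ^ (n + 1)) =
      (H (n + 1) : ℝ) / (val (n + 1) 1 * 16 ^ (n + 1)) *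
      (Real.exp (-(4 / 3 * Real.log 2 * (((n + 1 : ℕ) : ℝ) * (1 / 3) ^ (n + 1)))) *
        (Real.exp (-(Real.log 12 / 18)) / √3)) *
      Real.exp (Real.log ((2 : ℝ) ^ (8 * ((n + 1 : ℕ) : ℝ) / 3) / A (n + 1)) *
        ((3 + (1 / 3) ^ (n + 1)) / 2)) := by
  have h16 : (16 : ℝ) ^ (n + 1) = Real.exp (4 * Real.log 2 * ((n + 1 : ℕ) : ℝ)) := by
    rw [show (16 : ℝ) = 2 ^ 4 by norm_num, ← pow_mul, ← Real.exp_log (pow_pos two_pos _),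
      Real.log_pow]
    congr 1
    push_cast
    ring
  rw [Z, val_one_eq, h16, Real.log_div (by positivity) (hA _).ne', Real.log_rpow two_pos]
  field_simp
  simp only [mul_assoc, ← Real.exp_add]
  congr 2
  have h3 : (3 : ℝ) ^ n ≠ 0 := by positivity
  rw [div_pow, one_pow]
  field_simp
  ring

theorem exists_Z_eq {A : ℕ → ℝ} (hA : ∀ n, 0 < A n) :
    ∃ (Q e : ℕ → ℝ) (L : ℝ), 0 < L ∧ Tendsto Q atTop (𝓝 L) ∧ Tendsto e atTop (𝓝 (3 / 2)) ∧
      ∀ᶠ n in atTop, Q n * Real.exp (Real.log ((2 : ℝ) ^ (8 * (n : ℝ) / 3) / A n) * e n) =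
        Z n (Real.log 12 / 9 + Real.log (A n) / 3 ^ n) := by
  obtain ⟨L, hL, hH⟩ := tendsto_H_ratio
  have h1 := tendsto_self_mul_const_pow_of_lt_one (r := (1 / 3 : ℝ)) (by norm_num) (by norm_num)
  have h2 := tendsto_pow_atTop_nhds_zero_of_lt_one (r := (1 / 3 : ℝ)) (by norm_num) (by norm_num)
  have h3 := (h1.const_mul (4 / 3 * Real.log 2)).neg.rexp
  have h4 := (h2.const_add 3).div_const 2
  rw [mul_zero, neg_zero, Real.exp_zero] at h3
  rw [add_zero] at h4
  refine ⟨_, _, _, ?_, hH.mul (h3.mul_const (Real.exp (-(Real.log 12 / 18)) / √3)), h4, ?_⟩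
  · positivity
  · filter_upwards [eventually_ge_atTop 1] with n hn
    obtain ⟨n, rfl⟩ := Nat.exists_eq_add_of_le' hn
    exact (Z_eq hA n).symm

/-- fine scaling of the partition function of Hamiltonian paths
at the critical point. -/
theorem partition_function_scaling (A : ℕ → ℝ) (hA : ∀ n, 0 < A n) :
    (Filter.Tendsto (fun n : ℕ => (2 : ℝ) ^ (8 * (n : ℝ) / 3) / A n)
        Filter.atTop (nhds 0) →
      Filter.Tendsto (fun n : ℕ => Z n (Real.log 12 / 9 + Real.log (A n) / 3 ^ n))
        Filter.atTop (nhds 0)) ∧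
    (Filter.Tendsto (fun n : ℕ => (2 : ℝ) ^ (8 * (n : ℝ) / 3) / A n)
        Filter.atTop Filter.atTop →
      Filter.Tendsto (fun n : ℕ => Z n (Real.log 12 / 9 + Real.log (A n) / 3 ^ n))
        Filter.atTop Filter.atTop) ∧
    (Filter.Tendsto (fun n : ℕ => A n / (2 : ℝ) ^ (8 * (n : ℝ) / 3))
        Filter.atTop (nhds 1) →
      ∃ L : ℝ, 0 < L ∧
        Filter.Tendsto (fun n : ℕ => Z n (Real.log 12 / 9 + Real.log (A n) / 3 ^ n))
          Filter.atTop (nhds L)) := by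
  obtain ⟨Q, e, L, hL, hQ, he, hZ⟩ := exists_Z_eq hA
  have hr : ∀ n : ℕ, 0 < (2 : ℝ) ^ (8 * (n : ℝ) / 3) / A n := fun n =>
    div_pos (by positivity) (hA n)
  refine ⟨fun h => ?_, fun h => ?_, fun h => ⟨L, hL, ?_⟩⟩
  · have hlog := Real.tendsto_log_nhdsGT_zero.comp
      (tendsto_nhdsWithin_iff.2 ⟨h, Eventually.of_forall hr⟩)
    have := hQ.mul (Real.tendsto_exp_atBot.comp (hlog.atBot_mul_pos (by norm_num) he))
    rw [mul_zero] at this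
    exact this.congr' hZ
  · exact (hQ.pos_mul_atTop hL (Real.tendsto_exp_atTop.comp
      ((Real.tendsto_log_atTop.comp h).atTop_mul_pos (by norm_num) he))).congr' hZ
  · have h1 := h.inv₀ one_ne_zero
    simp only [inv_div, inv_one] at h1
    have := hQ.mul ((h1.log one_ne_zero).mul he).rexp
    rw [Real.log_one, zero_mul, Real.exp_zero, mul_one] at this
    exact this.congr' hZ

end SierpinskiGasket
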